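/- arXiv:math/0512067 — 4 statements merged into one kernel-verified Lean document; each statement's English description precedes it below -/
import Mathlib

section
/- Let n be a positive integer, let c_1,…,c_n > 0, let k_1 < k_2 < ⋯ < k_n be positive integers, let Σ_{N=0}^∞ b_N w^N be the power series expansion around the origin of the entire function f(w) := exp(Σ_{i=1}^n c_i w^{k_i}), and suppose that b_N > 0 for all sufficiently large N. Then b_{N−1}/b_N ∼ (N/(c_n k_n))^{1/k_n} as N → ∞. -/
noncomputable section
open Filter Topology


theorem hx_complex {ι : Type*} [Fintype ι] (c : ι → ℝ) (k : ι → ℕ) (b : ℕ → ℝ)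
    (hb : ∀ w : ℝ, HasSum (fun N => b N * w ^ N) (Real.exp (∑ i, c i * w ^ (k i)))) (z : ℂ) :
    HasSum (fun N => (b N : ℂ) * z ^ N) (Complex.exp (∑ i, (c i : ℂ) * z ^ (k i))) := by
  have hs : ∀ R : ℝ, 0 ≤ R → Summable (fun N => |b N| * R ^ N) := by
    intro R hR
    have := (hb R).summable.abs
    refine this.congr fun N => ?_
    rw [abs_mul, abs_of_nonneg (pow_nonneg hR N)]
  have hsz : ∀ z : ℂ, Summable (fun N => (b N : ℂ) * z ^ N) := by
    intro z
    refine Summable.of_norm ((hs ‖z‖ (norm_nonneg z)).congr fun N => ?_)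
    simp
  have hd : Differentiable ℂ (fun z : ℂ => ∑' N, (b N : ℂ) * z ^ N) := by
    intro z
    have h1 : DifferentiableOn ℂ (fun z : ℂ => ∑' N, (b N : ℂ) * z ^ N)
        (Metric.ball 0 (‖z‖ + 1)) := by
      refine Complex.differentiableOn_tsum_of_summable_norm
        (hs (‖z‖ + 1) (by positivity)) (fun N => ?_) Metric.isOpen_ball (fun N w hw => ?_)
      · fun_prop
      · have : ‖w‖ ≤ ‖z‖ + 1 := by
          have := mem_ball_zero_iff.1 hw
          exact this.le
        simp only [norm_mul, norm_pow, Complex.norm_real, Real.norm_eq_abs]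
        gcongr
    exact h1.differentiableAt (Metric.isOpen_ball.mem_nhds (by simp))
  have hd2 : Differentiable ℂ (fun z : ℂ => Complex.exp (∑ i, (c i : ℂ) * z ^ (k i))) := by
    fun_prop
  have heq : (fun z : ℂ => ∑' N, (b N : ℂ) * z ^ N) =
      fun z : ℂ => Complex.exp (∑ i, (c i : ℂ) * z ^ (k i)) := by
    refine AnalyticOnNhd.eq_of_frequently_eq (z₀ := 0)
      (fun z _ => hd.analyticAt z) (fun z _ => hd2.analyticAt z) ?_
    have hreal : ∀ w : ℝ, (∑' N, (b N : ℂ) * (w : ℂ) ^ N) =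
        Complex.exp (∑ i, (c i : ℂ) * (w : ℂ) ^ (k i)) := by
      intro w
      have := (Complex.hasSum_ofReal.2 (hb w)).tsum_eq
      push_cast at this
      exact this
    have ht : Tendsto (fun m : ℕ => (((1 / ((m : ℝ) + 1) : ℝ)) : ℂ)) atTop (𝓝[≠] 0) := by
      refine tendsto_nhdsWithin_iff.2 ⟨?_, Eventually.of_forall fun m => ?_⟩
      · have := (Complex.continuous_ofReal.tendsto 0).comp
          (tendsto_one_div_add_atTop_nhds_zero_nat (𝕜 := ℝ))
        rw [Complex.ofReal_zero] at this
        exact this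
      · have : (1 / ((m : ℝ) + 1) : ℝ) ≠ 0 := by positivity
        simpa only [Set.mem_compl_iff, Set.mem_singleton_iff, Complex.ofReal_eq_zero] using this
    exact ht.frequently (Eventually.of_forall fun m => hreal _).frequently
  have := (hsz z).hasSum
  rwa [show (∑' N, (b N : ℂ) * z ^ N) = _ from congrFun heq z] at this

theorem hx_coef {ι : Type*} [Fintype ι] (c : ι → ℝ) (k : ι → ℕ) (b : ℕ → ℝ)
    (hb : ∀ w : ℝ, HasSum (fun N => b N * w ^ N) (Real.exp (∑ i, c i * w ^ (k i))))
    (r : ℝ) (N : ℕ) :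
    ∫ θ in (-Real.pi)..Real.pi, Complex.exp (∑ i, (c i : ℂ) * (r * Complex.exp (θ * Complex.I)) ^ (k i))
      * Complex.exp (-(N * θ * Complex.I)) = 2 * Real.pi * b N * (r : ℂ) ^ N := by
  have hs : Summable (fun M => |b M| * |r| ^ M) := by
    have := (hb r).summable.abs
    exact this.congr fun N => by rw [abs_mul, abs_pow]
  let F : ℕ → C(ℝ, ℂ) := fun M => ⟨fun θ => (b M : ℂ) * (r * Complex.exp (θ * Complex.I)) ^ M
      * Complex.exp (-(N * θ * Complex.I)), by fun_prop⟩
  have hF : ∀ M θ, ‖F M θ‖ = |b M| * |r| ^ M := by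
    intro M θ
    have : Complex.exp (-(N * θ * Complex.I)) = Complex.exp (((-(N * θ) : ℝ) : ℂ) * Complex.I) := by
      push_cast; ring_nf
    simp only [F, ContinuousMap.coe_mk, this, norm_mul, norm_pow, Complex.norm_exp_ofReal_mul_I]
    simp
  have h := intervalIntegral.hasSum_integral_of_dominated_convergence
    (μ := MeasureTheory.volume) (a := -Real.pi) (b := Real.pi)
    (F := fun M θ => F M θ) (f := fun θ : ℝ =>
      Complex.exp (∑ i, (c i : ℂ) * (r * Complex.exp (θ * Complex.I)) ^ (k i))
      * Complex.exp (-(N * θ * Complex.I)))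
    (fun M _ => |b M| * |r| ^ M)
    (fun M => (F M).continuous.aestronglyMeasurable)
    (fun M => Eventually.of_forall fun θ _ => (hF M θ).le)
    (Eventually.of_forall fun θ _ => hs)
    intervalIntegrable_const
    (Eventually.of_forall fun θ _ =>
      (hx_complex c k b hb (r * Complex.exp (θ * Complex.I))).mul_right _)
  refine h.unique ?_
  have h3 : ∀ M, M ≠ N → ∫ θ in (-Real.pi)..Real.pi, F M θ = 0 := by
    intro M hM
    have hne : (((M : ℂ) - N) * Complex.I) ≠ 0 := by
      refine mul_ne_zero (sub_ne_zero.2 ?_) Complex.I_ne_zero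
      exact_mod_cast hM
    have : ∀ θ : ℝ, F M θ = (b M * (r : ℂ) ^ M) * Complex.exp ((((M : ℂ) - N) * Complex.I) * θ) := by
      intro θ
      simp only [F, ContinuousMap.coe_mk, mul_pow, ← Complex.exp_nat_mul]
      rw [mul_assoc, mul_assoc, ← Complex.exp_add, mul_assoc]
      ring_nf
    simp only [this]
    rw [intervalIntegral.integral_const_mul, integral_exp_mul_complex hne]
    have : Complex.exp (((M : ℂ) - N) * Complex.I * (Real.pi : ℝ)) =
        Complex.exp (((M : ℂ) - N) * Complex.I * ((-Real.pi : ℝ) : ℂ)) := by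
      rw [Complex.exp_eq_exp_iff_exists_int]
      refine ⟨(M : ℤ) - N, ?_⟩
      push_cast; ring
    rw [this]; simp
  have h4 : ∫ θ in (-Real.pi)..Real.pi, F N θ = 2 * Real.pi * b N * (r : ℂ) ^ N := by
    have : ∀ θ : ℝ, F N θ = (b N * (r : ℂ) ^ N) := by
      intro θ
      simp only [F, ContinuousMap.coe_mk, mul_pow, ← Complex.exp_nat_mul]
      rw [mul_assoc, mul_assoc, ← Complex.exp_add, ← mul_assoc (N : ℂ)]
      simp
    simp only [this, intervalIntegral.integral_const]
    simp; ring
  rw [← h4]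
  exact hasSum_single N h3

theorem hx_aper {ι : Type*} [Fintype ι] (c : ι → ℝ) (k : ι → ℕ) (b : ℕ → ℝ)
    (hb : ∀ w : ℝ, HasSum (fun N => b N * w ^ N) (Real.exp (∑ i, c i * w ^ (k i))))
    (hbpos : ∀ᶠ N in atTop, 0 < b N) (α : ℝ) (hα : ∀ i, Real.cos (k i * α) = 1) :
    ∃ m : ℤ, α = m * (2 * Real.pi) := by
  have hk : ∀ i, Complex.exp (α * Complex.I) ^ (k i) = 1 := by
    intro i
    obtain ⟨m, hm⟩ := (Real.cos_eq_one_iff _).1 (hα i)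
    rw [← Complex.exp_nat_mul, Complex.exp_eq_one_iff]
    refine ⟨m, ?_⟩
    have : (k i : ℂ) * α = m * (2 * Real.pi) := by exact_mod_cast hm.symm
    rw [← mul_assoc, this]; ring
  have key : ∀ N, 0 < b N → Complex.exp (-(N * α * Complex.I)) = 1 := by
    intro N hN
    have h0 := hx_coef c k b hb 1 N
    set g : ℝ → ℂ := fun θ => Complex.exp (∑ i, (c i : ℂ) * ((1:ℝ) * Complex.exp (θ * Complex.I)) ^ (k i))
      * Complex.exp (-(N * θ * Complex.I)) with hg
    have hper : Function.Periodic g (2 * Real.pi) := by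
      intro θ
      have e1 : Complex.exp (((θ + 2 * Real.pi : ℝ) : ℂ) * Complex.I) = Complex.exp (θ * Complex.I) := by
        push_cast
        rw [add_mul, Complex.exp_add, Complex.exp_two_pi_mul_I, mul_one]
      have e2 : Complex.exp (-(N * ((θ + 2 * Real.pi : ℝ) : ℂ) * Complex.I)) =
          Complex.exp (-(N * θ * Complex.I)) := by
        rw [Complex.exp_eq_exp_iff_exists_int]
        refine ⟨-(N : ℤ), ?_⟩
        push_cast; ring
      simp only [hg, e1, e2]
    have h1 : ∫ θ in (-Real.pi)..Real.pi, g (θ + α) = ∫ θ in (-Real.pi)..Real.pi, g θ := by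
      rw [intervalIntegral.integral_comp_add_right]
      have := hper.intervalIntegral_add_eq (-Real.pi + α) (-Real.pi)
      rw [show -Real.pi + α + 2 * Real.pi = Real.pi + α by ring,
        show -Real.pi + 2 * Real.pi = Real.pi by ring] at this
      exact this
    have h2 : ∀ θ, g (θ + α) = g θ * Complex.exp (-(N * α * Complex.I)) := by
      intro θ
      have e1 : ∀ i, Complex.exp (((θ + α : ℝ) : ℂ) * Complex.I) ^ (k i)
          = Complex.exp (θ * Complex.I) ^ (k i) := by
        intro i
        push_cast
        rw [add_mul, Complex.exp_add, mul_pow, hk, mul_one]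
      simp only [hg, mul_pow, e1]
      have e3 : Complex.exp (-(N * ((θ + α : ℝ) : ℂ) * Complex.I)) =
          Complex.exp (-(N * θ * Complex.I)) * Complex.exp (-(N * α * Complex.I)) := by
        rw [← Complex.exp_add]
        congr 1
        push_cast; ring
      rw [e3, ← mul_assoc]
    simp only [h2] at h1
    rw [intervalIntegral.integral_mul_const] at h1
    have hne : (∫ θ in (-Real.pi)..Real.pi, g θ) ≠ 0 := by
      rw [h0]
      have := hN.ne'
      have := Real.pi_ne_zero
      simp [*]
    exact mul_left_cancel₀ hne (by rw [h1, mul_one])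
  obtain ⟨N, hN⟩ := eventually_atTop.1 hbpos
  have k1 := key N (hN N le_rfl)
  have k2 := key (N + 1) (hN (N + 1) (by omega))
  have k3 : Complex.exp (-(α * Complex.I)) = 1 := by
    have : -(((N + 1 : ℕ) : ℂ) * α * Complex.I) = -(N * α * Complex.I) + -(α * Complex.I) := by
      push_cast; ring
    rw [this, Complex.exp_add, k1, one_mul] at k2
    exact k2
  obtain ⟨m, hm⟩ := Complex.exp_eq_one_iff.1 k3
  refine ⟨-m, ?_⟩
  have : (α : ℂ) = -m * (2 * Real.pi) := by
    have : (α : ℂ) * Complex.I = (-m * (2 * Real.pi)) * Complex.I := by linear_combination -hm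
    exact mul_right_cancel₀ Complex.I_ne_zero this
  exact_mod_cast this

theorem hx_gap {ι : Type*} [Fintype ι] (c : ι → ℝ) (k : ι → ℕ) (b : ℕ → ℝ)
    (hb : ∀ w : ℝ, HasSum (fun N => b N * w ^ N) (Real.exp (∑ i, c i * w ^ (k i))))
    (hc : ∀ i, 0 < c i)
    (hbpos : ∀ᶠ N in atTop, 0 < b N) (δ : ℝ) (hδ : 0 < δ) :
    ∃ m > 0, ∀ θ : ℝ, δ ≤ |θ| → |θ| ≤ Real.pi → m ≤ ∑ i, c i * (1 - Real.cos (k i * θ)) := by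
  have hcpt : IsCompact {θ : ℝ | δ ≤ |θ| ∧ |θ| ≤ Real.pi} := by
    refine (isCompact_Icc (a := -Real.pi) (b := Real.pi)).of_isClosed_subset ?_ ?_
    · exact (isClosed_le continuous_const continuous_abs).inter
        (isClosed_le continuous_abs continuous_const)
    · intro θ h; exact abs_le.1 h.2
  rcases Set.eq_empty_or_nonempty {θ : ℝ | δ ≤ |θ| ∧ |θ| ≤ Real.pi} with he | hne
  · refine ⟨1, one_pos, fun θ h1 h2 => ?_⟩
    have : θ ∈ {θ : ℝ | δ ≤ |θ| ∧ |θ| ≤ Real.pi} := ⟨h1, h2⟩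
    rw [he] at this; exact this.elim
  · obtain ⟨θ₀, h0, hmin⟩ := hcpt.exists_isMinOn hne
      (f := fun θ : ℝ => ∑ i, c i * (1 - Real.cos (k i * θ))) (by fun_prop)
    have hnn : ∀ i, 0 ≤ c i * (1 - Real.cos (k i * θ₀)) := fun i =>
      mul_nonneg (hc i).le (by linarith [Real.cos_le_one (k i * θ₀)])
    refine ⟨∑ i, c i * (1 - Real.cos (k i * θ₀)), ?_, fun θ h1 h2 => hmin ⟨h1, h2⟩⟩
    refine lt_of_le_of_ne (Finset.sum_nonneg fun i _ => hnn i) fun h => ?_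
    have hz := (Finset.sum_eq_zero_iff_of_nonneg (fun i _ => hnn i)).1 h.symm
    obtain ⟨m, hm⟩ := hx_aper c k b hb hbpos θ₀ (fun i => by
      have := hz i (Finset.mem_univ i)
      rcases mul_eq_zero.1 this with h | h
      · exact absurd h (hc i).ne'
      · linarith)
    have hpi := Real.pi_pos
    have h1 := h0.1
    have h2 := h0.2
    have hm0 : m ≠ 0 := by
      rintro rfl
      simp at hm; rw [hm] at h1; simp at h1; linarith
    have : (1 : ℝ) ≤ |(m : ℝ)| := by exact_mod_cast Int.one_le_abs hm0
    rw [hm, abs_mul, abs_of_pos (by positivity : 0 < 2 * Real.pi)] at h2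
    nlinarith

/-- The normalised integrand at the saddle radius. -/
def hxG {ι : Type*} [Fintype ι] (c : ι → ℝ) (k : ι → ℕ) (r θ : ℝ) : ℂ :=
  Complex.exp (∑ i, (c i : ℂ) * (r : ℂ) ^ (k i) *
    (Complex.exp (k i * θ * Complex.I) - 1 - k i * θ * Complex.I))

theorem hxG_norm {ι : Type*} [Fintype ι] (c : ι → ℝ) (k : ι → ℕ) (r θ : ℝ) :
    ‖hxG c k r θ‖ = Real.exp (-∑ i, r ^ (k i) * (c i * (1 - Real.cos (k i * θ)))) := by
  rw [hxG, Complex.norm_exp, Complex.re_sum, ← Finset.sum_neg_distrib]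
  congr 1
  refine Finset.sum_congr rfl fun i _ => ?_
  have h1 : (c i : ℂ) * (r : ℂ) ^ (k i) = ((c i * r ^ (k i) : ℝ) : ℂ) := by push_cast; ring
  have h2 : (k i : ℂ) * θ = ((k i * θ : ℝ) : ℂ) := by push_cast; ring
  rw [h1, h2, Complex.re_ofReal_mul]
  simp only [Complex.sub_re, Complex.exp_ofReal_mul_I_re, Complex.one_re, Complex.re_ofReal_mul,
    Complex.I_re]
  ring

theorem hxG_norm_le_one {ι : Type*} [Fintype ι] (c : ι → ℝ) (k : ι → ℕ) (hc : ∀ i, 0 < c i)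
    (r θ : ℝ) (hr : 0 ≤ r) : ‖hxG c k r θ‖ ≤ 1 := by
  rw [hxG_norm, Real.exp_le_one_iff, neg_nonpos]
  exact Finset.sum_nonneg fun i _ => mul_nonneg (pow_nonneg hr _)
    (mul_nonneg (hc i).le (by linarith [Real.cos_le_one (k i * θ)]))

theorem hxG_bound {ι : Type*} [Fintype ι] (c : ι → ℝ) (k : ι → ℕ) (b : ℕ → ℝ)
    (hb : ∀ w : ℝ, HasSum (fun N => b N * w ^ N) (Real.exp (∑ i, c i * w ^ (k i))))
    (hc : ∀ i, 0 < c i) (hk0 : ∀ i, 0 < k i) (l : ι)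
    (hbpos : ∀ᶠ N in atTop, 0 < b N) :
    ∃ K : ℝ, ∀ r θ : ℝ, 1 ≤ r → |θ| ≤ Real.pi → r ^ (k l) * θ ^ 2 * ‖hxG c k r θ‖ ≤ K := by
  have hpi := Real.pi_pos
  have hkl : (0 : ℝ) < k l := by exact_mod_cast hk0 l
  obtain ⟨m, hm0, hm⟩ := hx_gap c k b hb hc hbpos (Real.pi / k l) (by positivity)
  set a : ℝ := c l * (2 / Real.pi ^ 2 * (k l) ^ 2) with ha
  have ha0 : 0 < a := by have := hc l; positivity
  refine ⟨max (1 / a) (Real.pi ^ 2 * ((k l).factorial / m ^ (k l))), fun r θ hr hθ => ?_⟩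
  have hr0 : 0 < r := by linarith
  have hnn : ∀ i, 0 ≤ c i * (1 - Real.cos (k i * θ)) := fun i =>
      mul_nonneg (hc i).le (by linarith [Real.cos_le_one (k i * θ)])
  rw [hxG_norm]
  set E := ∑ i, r ^ (k i) * (c i * (1 - Real.cos (k i * θ))) with hE
  rcases le_total |θ| (Real.pi / k l) with h | h
  · refine le_trans ?_ (le_max_left _ _)
    have h1 : Real.cos (k l * θ) ≤ 1 - 2 / Real.pi ^ 2 * (k l * θ) ^ 2 := by
      apply Real.cos_le_one_sub_mul_cos_sq
      rw [abs_mul, abs_of_pos hkl]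
      rw [le_div_iff₀ hkl] at h
      linarith
    have h2 : a * (r ^ (k l) * θ ^ 2) ≤ E := by
      have h3 : r ^ (k l) * (c l * (1 - Real.cos (k l * θ))) ≤ E :=
        Finset.single_le_sum (f := fun i => r ^ (k i) * (c i * (1 - Real.cos (k i * θ))))
          (fun i _ => mul_nonneg (pow_nonneg hr0.le _) (hnn i)) (Finset.mem_univ l)
      refine le_trans ?_ h3
      have h4 : c l * (2 / Real.pi ^ 2 * (k l * θ) ^ 2) ≤ c l * (1 - Real.cos (k l * θ)) :=
        mul_le_mul_of_nonneg_left (by linarith) (hc l).le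
      have h5 := mul_le_mul_of_nonneg_left h4 (pow_nonneg hr0.le (k l))
      refine le_trans (le_of_eq ?_) h5
      rw [ha]; ring
    rw [Real.exp_neg, ← div_eq_mul_inv, div_le_div_iff₀ (Real.exp_pos _) ha0]
    have := Real.add_one_le_exp E
    nlinarith
  · refine le_trans ?_ (le_max_right _ _)
    have h1 : m * r ≤ E := by
      calc m * r ≤ (∑ i, c i * (1 - Real.cos (k i * θ))) * r :=
            mul_le_mul_of_nonneg_right (hm θ h hθ) hr0.le
        _ ≤ E := by
          rw [Finset.sum_mul]
          refine Finset.sum_le_sum fun i _ => ?_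
          rw [mul_comm]
          exact mul_le_mul_of_nonneg_right (le_self_pow₀ hr (hk0 i).ne') (hnn i)
    have h2 : (m * r) ^ (k l) / (k l).factorial ≤ Real.exp E :=
      (Real.pow_div_factorial_le_exp _ (by positivity) _).trans (Real.exp_le_exp.2 h1)
    have h3 : θ ^ 2 ≤ Real.pi ^ 2 := sq_le_sq' (by linarith [(abs_le.1 hθ).1]) (abs_le.1 hθ).2
    have h4 : r ^ (k l) * Real.exp (-E) ≤ (k l).factorial / m ^ (k l) := by
      rw [Real.exp_neg, ← div_eq_mul_inv, div_le_div_iff₀ (Real.exp_pos _) (by positivity)]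
      rw [div_le_iff₀ (by positivity), mul_pow] at h2
      linarith
    calc r ^ (k l) * θ ^ 2 * Real.exp (-E) = θ ^ 2 * (r ^ (k l) * Real.exp (-E)) := by ring
      _ ≤ _ := mul_le_mul h3 h4 (by positivity) (by positivity)

theorem hx_ratio_pow (r : ℕ → ℝ) (hr : Tendsto r atTop atTop) (p q : ℕ) (hpq : p < q) :
    Tendsto (fun N => (r N) ^ p / (r N) ^ q) atTop (𝓝 0) := by
  have h := (tendsto_pow_atTop (α := ℝ) (n := q - p) (by omega)).comp hr
  refine h.inv_tendsto_atTop.congr' ?_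
  filter_upwards [hr.eventually_gt_atTop 0] with N hN
  simp only [Pi.inv_apply, Function.comp]
  rw [eq_div_iff (by positivity), inv_mul_eq_div, div_eq_iff (by positivity), ← pow_add]
  congr 1; omega

theorem hxG_lim {ι : Type*} [Fintype ι] [DecidableEq ι] (c : ι → ℝ) (k : ι → ℕ) (l : ι)
    (hkl0 : 0 < k l)
    (hkl : ∀ i, i ≠ l → k i < k l) (r : ℕ → ℝ) (hr : Tendsto r atTop atTop) (t : ℝ) :
    Tendsto (fun N => hxG c k (r N) (t / √((r N) ^ (k l)))) atTop
      (𝓝 ((Real.exp (-(c l * (k l) ^ 2 / 2) * t ^ 2) : ℝ) : ℂ)) := by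
  have hs : Tendsto (fun N => √((r N) ^ (k l))) atTop atTop :=
    Real.tendsto_sqrt_atTop.comp ((tendsto_pow_atTop hkl0.ne').comp hr)
  have hsi : Tendsto (fun N => (√((r N) ^ (k l)))⁻¹) atTop (𝓝 0) := hs.inv_tendsto_atTop
  have hrat : ∀ i, Tendsto (fun N => (r N) ^ (k i) / (r N) ^ (k l)) atTop
      (𝓝 (if i = l then 1 else 0)) := by
    intro i
    split_ifs with h
    · subst h
      refine tendsto_const_nhds.congr' ?_
      filter_upwards [hr.eventually_gt_atTop 0] with N hN
      rw [div_self (by positivity)]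
    · exact hx_ratio_pow r hr _ _ (hkl i h)
  have hterm : ∀ i, Tendsto (fun N => (c i : ℂ) * (r N : ℂ) ^ (k i) *
      (Complex.exp (k i * ((t / √((r N) ^ (k l)) : ℝ) : ℂ) * Complex.I) - 1
        - k i * ((t / √((r N) ^ (k l)) : ℝ) : ℂ) * Complex.I)) atTop
      (𝓝 (if i = l then (((-(c l * (k l) ^ 2 / 2) * t ^ 2) : ℝ) : ℂ) else 0)) := by
    intro i
    have hz : Tendsto (fun N => (k i : ℂ) * ((t / √((r N) ^ (k l)) : ℝ) : ℂ) * Complex.I) atTop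
        (𝓝 0) := by
      have h1 : Tendsto (fun N => t / √((r N) ^ (k l))) atTop (𝓝 0) := by
        simpa [div_eq_mul_inv] using hsi.const_mul t
      have h2 := (Complex.continuous_ofReal.tendsto 0).comp h1
      have h3 := (h2.const_mul (k i : ℂ)).mul_const Complex.I
      simpa using h3
    have hA : Tendsto (fun N => (c i : ℂ) * (r N : ℂ) ^ (k i) *
        (((k i : ℂ) * ((t / √((r N) ^ (k l)) : ℝ) : ℂ) * Complex.I) ^ 2 / 2)) atTop
        (𝓝 (if i = l then (((-(c l * (k l) ^ 2 / 2) * t ^ 2) : ℝ) : ℂ) else 0)) := by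
      have h1 := (hrat i).const_mul (-(c i * (k i) ^ 2 / 2) * t ^ 2)
      have h2 := (Complex.continuous_ofReal.tendsto _).comp h1
      have h3 : (((-(c i * (k i) ^ 2 / 2) * t ^ 2 * (if i = l then 1 else 0)) : ℝ) : ℂ) =
          (if i = l then (((-(c l * (k l) ^ 2 / 2) * t ^ 2) : ℝ) : ℂ) else 0) := by
        split_ifs with h
        · subst h; simp
        · simp
      rw [h3] at h2
      refine h2.congr' ?_
      filter_upwards [hr.eventually_gt_atTop 0] with N hN
      have hsq : (√((r N) ^ (k l))) ^ 2 = (r N) ^ (k l) := Real.sq_sqrt (by positivity)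
      have h4 : ((k i : ℂ) * ((t / √((r N) ^ (k l)) : ℝ) : ℂ) * Complex.I) ^ 2
          = (-((k i) ^ 2 * (t ^ 2 / (r N) ^ (k l))) : ℝ) := by
        have h5 : t ^ 2 / (r N) ^ (k l) = (t / √((r N) ^ (k l))) ^ 2 := by rw [div_pow, hsq]
        rw [h5, mul_pow, Complex.I_sq]
        push_cast; ring
      rw [h4]
      simp only [Function.comp]
      push_cast
      ring
    have hB : Tendsto (fun N => (c i : ℂ) * (r N : ℂ) ^ (k i) *
        (Complex.exp (k i * ((t / √((r N) ^ (k l)) : ℝ) : ℂ) * Complex.I) - 1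
        - k i * ((t / √((r N) ^ (k l)) : ℝ) : ℂ) * Complex.I
        - ((k i : ℂ) * ((t / √((r N) ^ (k l)) : ℝ) : ℂ) * Complex.I) ^ 2 / 2)) atTop (𝓝 0) := by
      have h1 : Tendsto (fun N => |c i| * ((k i) ^ 3 * |t| ^ 3) * ((r N) ^ (k i) / (r N) ^ (k l))
          * (√((r N) ^ (k l)))⁻¹) atTop (𝓝 0) := by
        simpa using ((hrat i).const_mul (|c i| * ((k i) ^ 3 * |t| ^ 3))).mul hsi
      refine squeeze_zero_norm' ?_ h1
      have hz1 : ∀ᶠ N in atTop, ‖(k i : ℂ) * ((t / √((r N) ^ (k l)) : ℝ) : ℂ) * Complex.I‖ < 1 := by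
        have := hz.norm
        rw [norm_zero] at this
        exact this.eventually (gt_mem_nhds one_pos)
      filter_upwards [hr.eventually_gt_atTop 0, hz1] with N hN hzN
      have hsq : (√((r N) ^ (k l))) ^ 2 = (r N) ^ (k l) := Real.sq_sqrt (by positivity)
      have hspos : 0 < √((r N) ^ (k l)) := Real.sqrt_pos.2 (by positivity)
      have hnz : ‖(k i : ℂ) * ((t / √((r N) ^ (k l)) : ℝ) : ℂ) * Complex.I‖
          = k i * (|t| / √((r N) ^ (k l))) := by
        rw [norm_mul, norm_mul, Complex.norm_I, Complex.norm_natCast, Complex.norm_real,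
          Real.norm_eq_abs, abs_div, abs_of_pos hspos, mul_one]
      have hb := Complex.exp_bound hzN.le (n := 3) (by norm_num)
      rw [hnz] at hb
      generalize (k i : ℂ) * ((t / √((r N) ^ (k l)) : ℝ) : ℂ) * Complex.I = z at hb ⊢
      have e1 : Complex.exp z - 1 - z - z ^ 2 / 2 =
          Complex.exp z - ∑ m ∈ Finset.range 3, z ^ m / (m.factorial : ℂ) := by
        simp [Finset.sum_range_succ, Nat.factorial]; ring
      rw [norm_mul, norm_mul, norm_pow, Complex.norm_real, Complex.norm_real, Real.norm_eq_abs,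
        Real.norm_eq_abs, abs_of_pos hN, e1]
      have hb2 : (k i * (|t| / √((r N) ^ (k l)))) ^ 3 *
          (((3 : ℕ).succ : ℝ) * (((3 : ℕ).factorial : ℝ) * (3 : ℕ))⁻¹) ≤
          (k i * (|t| / √((r N) ^ (k l)))) ^ 3 := by
        refine mul_le_of_le_one_right (by positivity) ?_
        norm_num [Nat.factorial]
      have hb3 := mul_le_mul_of_nonneg_left (hb.trans hb2)
        (by positivity : 0 ≤ |c i| * (r N) ^ (k i))
      refine hb3.trans (le_of_eq ?_)
      have hc3 : (r N) ^ (k i) / (r N) ^ (k l) = (r N) ^ (k i) / (√((r N) ^ (k l))) ^ 2 := by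
        rw [hsq]
      rw [hc3]
      field_simp
    have := hA.add hB
    rw [add_zero] at this
    refine this.congr fun N => ?_
    ring
  have hsum := tendsto_finsetSum Finset.univ (fun i _ => hterm i)
  rw [Finset.sum_ite_eq' Finset.univ l] at hsum
  simp only [Finset.mem_univ, if_true] at hsum
  have := (Complex.continuous_exp.tendsto _).comp hsum
  rw [← Complex.ofReal_exp] at this
  exact this

theorem hxG_int {ι : Type*} [Fintype ι] [DecidableEq ι] (c : ι → ℝ) (k : ι → ℕ) (b : ℕ → ℝ)
    (hb : ∀ w : ℝ, HasSum (fun N => b N * w ^ N) (Real.exp (∑ i, c i * w ^ (k i))))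
    (hc : ∀ i, 0 < c i) (hk0 : ∀ i, 0 < k i) (l : ι)
    (hkl : ∀ i, i ≠ l → k i < k l)
    (hbpos : ∀ᶠ N in atTop, 0 < b N) (r : ℕ → ℝ) (hr : Tendsto r atTop atTop)
    (u : ℝ → ℂ) (hu : Continuous u) (hu0 : u 0 = 1) (hu1 : ∀ x, ‖u x‖ ≤ 1) :
    Tendsto (fun N => ((√((r N) ^ (k l)) : ℝ) : ℂ) *
        ∫ θ in (-Real.pi)..Real.pi, u θ * hxG c k (r N) θ) atTop
      (𝓝 ((√(Real.pi / (c l * (k l) ^ 2 / 2)) : ℝ) : ℂ)) := by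
  have hpi := Real.pi_pos
  obtain ⟨K, hK⟩ := hxG_bound c k b hb hc hk0 l hbpos
  have hs : Tendsto (fun N => √((r N) ^ (k l))) atTop atTop :=
    Real.tendsto_sqrt_atTop.comp ((tendsto_pow_atTop (hk0 l).ne').comp hr)
  have hcont : ∀ N, Continuous (fun θ => u θ * hxG c k (r N) θ) := by
    intro N
    unfold hxG
    fun_prop
  have hmain := MeasureTheory.tendsto_integral_filter_of_dominated_convergence
    (μ := MeasureTheory.volume) (l := atTop)
    (F := fun (N : ℕ) (t : ℝ) => Set.indicator
      (Set.Ioc (-(Real.pi * √((r N) ^ (k l)))) (Real.pi * √((r N) ^ (k l))))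
      (fun t => u (t / √((r N) ^ (k l))) * hxG c k (r N) (t / √((r N) ^ (k l)))) t)
    (f := fun t : ℝ => ((Real.exp (-(c l * (k l) ^ 2 / 2) * t ^ 2) : ℝ) : ℂ))
    (fun t => (K + 1) * (1 + t ^ 2)⁻¹) ?_ ?_ (integrable_inv_one_add_sq.const_mul _) ?_
  · rw [integral_complex_ofReal, integral_gaussian] at hmain
    refine hmain.congr' ?_
    filter_upwards [hs.eventually_gt_atTop 0] with N hN
    rw [MeasureTheory.integral_indicator measurableSet_Ioc,
      ← intervalIntegral.integral_of_le (by nlinarith),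
      intervalIntegral.integral_comp_div (fun θ => u θ * hxG c k (r N) θ) hN.ne',
      neg_div, mul_div_cancel_right₀ _ hN.ne', Complex.real_smul]
  · filter_upwards with N
    exact (((hcont N).comp (continuous_id.div_const _)).aestronglyMeasurable).indicator
      measurableSet_Ioc
  · filter_upwards [hs.eventually_gt_atTop 0, hr.eventually_ge_atTop 1] with N hN hrN
    refine Eventually.of_forall fun t => ?_
    have hsq : (√((r N) ^ (k l))) ^ 2 = (r N) ^ (k l) := Real.sq_sqrt (by positivity)
    have hK0 : 0 ≤ K := by
      refine le_trans ?_ (hK 1 0 le_rfl (by simpa using hpi.le))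
      positivity
    by_cases ht : t ∈ Set.Ioc (-(Real.pi * √((r N) ^ (k l)))) (Real.pi * √((r N) ^ (k l)))
    · rw [Set.indicator_of_mem ht, norm_mul]
      have h1 : |t / √((r N) ^ (k l))| ≤ Real.pi := by
        rw [abs_div, abs_of_pos hN, div_le_iff₀ hN]
        exact abs_le.2 ⟨ht.1.le, ht.2⟩
      have h2 := hK (r N) _ hrN h1
      have h3 := hxG_norm_le_one c k hc (r N) (t / √((r N) ^ (k l))) (by linarith)
      have h4 : (r N) ^ (k l) * (t / √((r N) ^ (k l))) ^ 2 = t ^ 2 := by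
        rw [div_pow, hsq]; field_simp
      rw [h4] at h2
      have h5 := mul_le_mul (hu1 (t / √((r N) ^ (k l))))
        (le_refl ‖hxG c k (r N) (t / √((r N) ^ (k l)))‖) (norm_nonneg _) zero_le_one
      refine h5.trans ?_
      rw [one_mul, ← div_eq_mul_inv, le_div_iff₀ (by positivity)]
      linarith
    · rw [Set.indicator_of_notMem ht, norm_zero]
      positivity
  · refine Eventually.of_forall fun t => ?_
    have h1 : Tendsto (fun N => t / √((r N) ^ (k l))) atTop (𝓝 0) := by
      simpa [div_eq_mul_inv] using hs.inv_tendsto_atTop.const_mul t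
    have h2 : Tendsto (fun N => u (t / √((r N) ^ (k l)))) atTop (𝓝 1) := by
      rw [← hu0]; exact (hu.tendsto 0).comp h1
    have h3 := h2.mul (hxG_lim c k l (hk0 l) hkl r hr t)
    rw [one_mul] at h3
    refine h3.congr' ?_
    filter_upwards [hs.eventually_gt_atTop |t|] with N hN
    rw [Set.indicator_of_mem]
    have : |t| < Real.pi * √((r N) ^ (k l)) := by
      nlinarith [Real.pi_gt_three, abs_nonneg t]
    exact ⟨(abs_lt.1 this).1, (abs_lt.1 this).2.le⟩

theorem hx_saddle {ι : Type*} [Fintype ι] (c : ι → ℝ) (k : ι → ℕ)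
    (hc : ∀ i, 0 < c i) (hk0 : ∀ i, 0 < k i) (l : ι) :
    ∃ r : ℕ → ℝ, Tendsto r atTop atTop ∧ ∀ N, ∑ i, c i * k i * (r N) ^ (k i) = N := by
  have hkl : (0 : ℝ) < k l := by exact_mod_cast hk0 l
  have hcl := hc l
  have hex : ∀ N : ℕ, ∃ x : ℝ, 0 ≤ x ∧ ∑ i, c i * k i * x ^ (k i) = N := by
    intro N
    set X : ℝ := max 1 (N / (c l * k l)) with hX
    have hX1 : 1 ≤ X := le_max_left _ _
    have h0 : (∑ i, c i * k i * (0:ℝ) ^ (k i)) = 0 :=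
      Finset.sum_eq_zero fun i _ => by rw [zero_pow (hk0 i).ne', mul_zero]
    have h1 : (N : ℝ) ≤ ∑ i, c i * k i * X ^ (k i) := by
      have h2 : c l * k l * X ^ (k l) ≤ ∑ i, c i * k i * X ^ (k i) :=
        Finset.single_le_sum (f := fun i => c i * k i * X ^ (k i))
          (fun i _ => by have := hc i; positivity) (Finset.mem_univ l)
      have h3 : X ≤ X ^ (k l) := le_self_pow₀ hX1 (hk0 l).ne'
      have h4 : N / (c l * k l) ≤ X := le_max_right _ _
      rw [div_le_iff₀ (by positivity)] at h4
      have := mul_le_mul_of_nonneg_left h3 (by positivity : 0 ≤ c l * k l)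
      linarith
    obtain ⟨x, hx, hxe⟩ := intermediate_value_Icc (a := 0) (b := X) (by linarith)
      (f := fun x : ℝ => ∑ i, c i * k i * x ^ (k i)) (by fun_prop)
      (show (N : ℝ) ∈ _ from ⟨by simp only [h0]; positivity, h1⟩)
    exact ⟨x, hx.1, hxe⟩
  choose r hr0 hr using hex
  refine ⟨r, ?_, hr⟩
  refine tendsto_atTop.2 fun R => ?_
  obtain ⟨M, hM⟩ := exists_nat_gt (∑ i, c i * k i * R ^ (k i))
  filter_upwards [eventually_ge_atTop M] with N hN
  by_contra! hlt
  have h1 : (∑ i, c i * k i * (r N) ^ (k i)) ≤ ∑ i, c i * k i * R ^ (k i) := by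
    refine Finset.sum_le_sum fun i _ => ?_
    have := hc i
    have := hr0 N
    gcongr
  rw [hr N] at h1
  have : (M : ℝ) ≤ N := by exact_mod_cast hN
  linarith

theorem hxG_eq {ι : Type*} [Fintype ι] (c : ι → ℝ) (k : ι → ℕ) (r θ : ℝ) (N : ℕ)
    (h : ∑ i, c i * k i * r ^ (k i) = N) :
    Complex.exp (∑ i, (c i : ℂ) * (r * Complex.exp (θ * Complex.I)) ^ (k i))
      * Complex.exp (-(N * θ * Complex.I)) =
    Complex.exp (∑ i, (c i : ℂ) * (r : ℂ) ^ (k i)) * hxG c k r θ := by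
  have hN : (N : ℂ) = ∑ i, (c i : ℂ) * k i * (r : ℂ) ^ (k i) := by
    have := congrArg (fun x : ℝ => (x : ℂ)) h
    push_cast at this
    exact this.symm
  rw [hxG, ← Complex.exp_add, ← Complex.exp_add, hN, Finset.sum_mul, Finset.sum_mul,
    ← Finset.sum_neg_distrib, ← Finset.sum_add_distrib, ← Finset.sum_add_distrib]
  congr 1
  refine Finset.sum_congr rfl fun i _ => ?_
  rw [mul_pow, ← Complex.exp_nat_mul, ← mul_assoc (k i : ℂ)]
  ring

theorem hx_main {ι : Type*} [Fintype ι] [DecidableEq ι] (c : ι → ℝ) (k : ι → ℕ) (b : ℕ → ℝ)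
    (hb : ∀ w : ℝ, HasSum (fun N => b N * w ^ N) (Real.exp (∑ i, c i * w ^ (k i))))
    (hc : ∀ i, 0 < c i) (hk0 : ∀ i, 0 < k i) (l : ι)
    (hkl : ∀ i, i ≠ l → k i < k l)
    (hbpos : ∀ᶠ N in atTop, 0 < b N) :
    Tendsto (fun N : ℕ => (b (N - 1) / b N) /
        (((N : ℝ) / (c l * (k l : ℝ))) ^ ((1 : ℝ) / (k l : ℝ)))) atTop (𝓝 1) := by
  have hpi := Real.pi_pos
  have hkl0 : (0 : ℝ) < k l := by exact_mod_cast hk0 l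
  have hcl := hc l
  obtain ⟨r, hr, hrN⟩ := hx_saddle c k hc hk0 l
  have hs : Tendsto (fun N => √((r N) ^ (k l))) atTop atTop :=
    Real.tendsto_sqrt_atTop.comp ((tendsto_pow_atTop (hk0 l).ne').comp hr)
  have I0 := hxG_int c k b hb hc hk0 l hkl hbpos r hr (fun _ => 1) continuous_const rfl
    (fun _ => by simp)
  have I1 := hxG_int c k b hb hc hk0 l hkl hbpos r hr (fun θ => Complex.exp (θ * Complex.I))
    (by fun_prop) (by simp) (fun θ => (Complex.norm_exp_ofReal_mul_I θ).le)
  set L : ℝ := √(Real.pi / (c l * (k l) ^ 2 / 2)) with hL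
  have hLpos : 0 < L := Real.sqrt_pos.2 (by positivity)
  have hLne : (L : ℂ) ≠ 0 := by exact_mod_cast hLpos.ne'
  have hq := I1.div I0 hLne
  rw [div_self hLne] at hq
  have hq2 : Tendsto (fun N => ((b (N - 1) / b N / r N : ℝ) : ℂ)) atTop (𝓝 1) := by
    refine hq.congr' ?_
    filter_upwards [hs.eventually_gt_atTop 0, hr.eventually_gt_atTop 0, eventually_ge_atTop 1,
      hbpos] with N hsN hrpos hN1 hbN
    set f0 := Complex.exp (∑ i, (c i : ℂ) * (r N : ℂ) ^ (k i)) with hf0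
    have hf0ne : f0 ≠ 0 := Complex.exp_ne_zero _
    have e0 : f0 * ∫ θ in (-Real.pi)..Real.pi, (1 : ℂ) * hxG c k (r N) θ =
        2 * Real.pi * b N * (r N : ℂ) ^ N := by
      rw [← hx_coef c k b hb (r N) N, ← intervalIntegral.integral_const_mul]
      refine intervalIntegral.integral_congr fun θ _ => ?_
      show _ = _
      rw [hxG_eq c k (r N) θ N (hrN N), one_mul]
    have e1 : f0 * ∫ θ in (-Real.pi)..Real.pi, Complex.exp (θ * Complex.I) * hxG c k (r N) θ =
        2 * Real.pi * b (N - 1) * (r N : ℂ) ^ (N - 1) := by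
      rw [← hx_coef c k b hb (r N) (N - 1), ← intervalIntegral.integral_const_mul]
      refine intervalIntegral.integral_congr fun θ _ => ?_
      show _ = _
      have e2 : Complex.exp (-(((N - 1 : ℕ) : ℂ) * θ * Complex.I)) =
          Complex.exp (θ * Complex.I) * Complex.exp (-(N * θ * Complex.I)) := by
        rw [← Complex.exp_add, Nat.cast_sub hN1]
        congr 1; push_cast; ring
      rw [e2]
      linear_combination -Complex.exp (θ * Complex.I) * hxG_eq c k (r N) θ N (hrN N)
    have hsne : ((√((r N) ^ (k l)) : ℝ) : ℂ) ≠ 0 := by exact_mod_cast hsN.ne'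
    have hrne : (r N : ℂ) ≠ 0 := by exact_mod_cast hrpos.ne'
    have hbne : (b N : ℂ) ≠ 0 := by exact_mod_cast hbN.ne'
    have hpine : (Real.pi : ℂ) ≠ 0 := by exact_mod_cast hpi.ne'
    simp only [Pi.div_apply]
    rw [mul_div_mul_left _ _ hsne, ← mul_div_mul_left _ _ hf0ne, e0, e1]
    obtain ⟨M, rfl⟩ : ∃ M, N = M + 1 := ⟨N - 1, by omega⟩
    simp only [Nat.add_sub_cancel, pow_succ] at *
    push_cast
    field_simp
  have hq3 : Tendsto (fun N => b (N - 1) / b N / r N) atTop (𝓝 1) := by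
    have := (Complex.continuous_re.tendsto _).comp hq2
    simpa [Function.comp_def, -Complex.ofReal_div] using this
  have hQ : Tendsto (fun N : ℕ => ((N : ℝ) / (c l * k l)) / (r N) ^ (k l)) atTop (𝓝 1) := by
    have h1 : ∀ i, Tendsto (fun N => c i * k i / (c l * k l) * ((r N) ^ (k i) / (r N) ^ (k l)))
        atTop (𝓝 (if i = l then 1 else 0)) := by
      intro i
      split_ifs with h
      · subst h
        refine tendsto_const_nhds.congr' ?_
        filter_upwards [hr.eventually_gt_atTop 0] with N hN
        field_simp
      · simpa using (hx_ratio_pow r hr _ _ (hkl i h)).const_mul (c i * k i / (c l * k l))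
    have h2 := tendsto_finsetSum Finset.univ (fun i _ => h1 i)
    rw [Finset.sum_ite_eq' Finset.univ l] at h2
    simp only [Finset.mem_univ, if_true] at h2
    refine h2.congr fun N => ?_
    rw [← hrN N, Finset.sum_div, Finset.sum_div]
    refine Finset.sum_congr rfl fun i _ => ?_
    ring
  have hQ2 : Tendsto (fun N : ℕ => ((N : ℝ) / (c l * k l)) ^ ((1 : ℝ) / (k l : ℝ)) / r N)
      atTop (𝓝 1) := by
    have h1 := hQ.rpow_const (p := (1 : ℝ) / (k l : ℝ)) (Or.inl one_ne_zero)
    rw [Real.one_rpow] at h1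
    refine h1.congr' ?_
    filter_upwards [hr.eventually_gt_atTop 0] with N hN
    rw [Real.div_rpow (by positivity) (by positivity), one_div,
      Real.pow_rpow_inv_natCast hN.le (hk0 l).ne']
  have h := hq3.div hQ2 one_ne_zero
  rw [div_one] at h
  refine h.congr' ?_
  filter_upwards [hr.eventually_gt_atTop 0] with N hN
  simp only [Pi.div_apply]
  rw [div_div_div_cancel_right₀ hN.ne']


/-- Let `c_1,…,c_n > 0`, `k_1 < ⋯ < k_n` positive integers, and let
`Σ b_N w^N` be the power series expansion of `f(w) = exp(Σ c_i w^{k_i})`, with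
`b_N > 0` for all large `N`. Then `b_{N−1}/b_N ∼ (N/(c_n k_n))^{1/k_n}` as `N → ∞`. -/
theorem hayman_ratio_asymptotics (n : ℕ) (hn : 0 < n)
    (c : Fin n → ℝ) (hc : ∀ i, 0 < c i)
    (k : Fin n → ℕ) (hk0 : ∀ i, 0 < k i) (hkmono : StrictMono k)
    (b : ℕ → ℝ)
    (hb : ∀ w : ℝ, HasSum (fun N => b N * w ^ N)
      (Real.exp (∑ i, c i * w ^ (k i))))
    (hbpos : ∀ᶠ N in atTop, 0 < b N) :
    Tendsto
      (fun N : ℕ => (b (N - 1) / b N) /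
        (((N : ℝ) / (c ⟨n - 1, by omega⟩ * (k ⟨n - 1, by omega⟩ : ℝ))) ^
          ((1 : ℝ) / (k ⟨n - 1, by omega⟩ : ℝ))))
      atTop (𝓝 1) := by
  refine hx_main c k b hb hc hk0 ⟨n - 1, by omega⟩ (fun i hi => hkmono ?_) hbpos
  rw [Fin.lt_def]
  have h1 := i.isLt
  have h2 : i.val ≠ n - 1 := fun h => hi (Fin.ext h)
  show i.val < n - 1
  omega
end
end

section
/- Let A be a non-empty finite set of positive integers, let d = max A, and let k ∈ A. Then p_N^(A)(k) ∼ N^{(k/d)−1} as N → ∞ along those N with S_N^(A) ≠ ∅; that is, the ratio p_N^(A)(k) / N^{(k/d)−1} tends to 1 as N → ∞ restricted to N with S_N^(A) ≠ ∅. -/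
noncomputable section

open Filter Topology

/-- `permSet A N` is `S_N^(A)`: the set of permutations of `{1,…,N}` (modeled as
`Fin N`) all of whose cycles have length belonging to `A`; the length of the cycle
of `σ` containing `i` is the minimal period of `i` under `σ`. -/
def permSet (A : Set ℕ) (N : ℕ) : Set (Equiv.Perm (Fin N)) :=
  {σ | ∀ i : Fin N, Function.minimalPeriod (⇑σ) i ∈ A}

/-- `pN A k N` is `p_N^(A)(k)`: the probability that, in a uniformly random
permutation from `S_N^(A)`, the first element belongs to a cycle of length `k`. -/
def pN (A : Set ℕ) (k N : ℕ) : ℝ :=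
  (Nat.card {σ : Equiv.Perm (Fin N) // σ ∈ permSet A N ∧
      ∃ i : Fin N, (i : ℕ) = 0 ∧ Function.minimalPeriod (⇑σ) i = k} : ℝ) /
    (Nat.card ↥(permSet A N) : ℝ)

section Comb
open Function

def cnt (A : Set ℕ) (α : Type) : ℕ :=
  Nat.card {σ : Equiv.Perm α // ∀ i, minimalPeriod (⇑σ) i ∈ A}

lemma mp_semiconj {α β : Type} (f : α → α) (g : β → β) (φ : α → β) (hφ : Injective φ)
    (h : ∀ x, φ (f x) = g (φ x)) (x : α) : minimalPeriod g (φ x) = minimalPeriod f x := by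
  rw [minimalPeriod_eq_minimalPeriod_iff]
  intro n
  have hs : Semiconj φ f g := h
  have := (hs.iterate_right n) x
  simp only [IsPeriodicPt, IsFixedPt, ← this]
  exact hφ.eq_iff

lemma cnt_congr (A : Set ℕ) {α β : Type} (φ : α ≃ β) : cnt A α = cnt A β := by
  refine Nat.card_congr (Equiv.subtypeEquiv φ.permCongr fun σ => ?_)
  constructor
  · intro h i
    have := mp_semiconj σ (φ.permCongr σ) φ φ.injective (by simp) (φ.symm i)
    rw [φ.apply_symm_apply] at this
    rw [this]; exact h _
  · intro h i
    have := mp_semiconj σ (φ.permCongr σ) φ φ.injective (by simp) i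
    rw [← this]; exact h _

lemma mp_add_one (k : ℕ) (i : ZMod k) : minimalPeriod (fun j : ZMod k => j + 1) i = k := by
  have h : ∀ n : ℕ, (fun j : ZMod k => j + 1)^[n] i = i + n := by
    intro n
    induction n with
    | zero => simp
    | succ n ih => rw [iterate_succ_apply', ih]; push_cast; ring
  apply Nat.dvd_antisymm
  · rw [← isPeriodicPt_iff_minimalPeriod_dvd]
    simp [IsPeriodicPt, IsFixedPt, h]
  · have := isPeriodicPt_minimalPeriod (fun j : ZMod k => j + 1) i
    rw [IsPeriodicPt, IsFixedPt, h] at this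
    rw [← ZMod.natCast_eq_zero_iff]
    simpa using this

/-- permutations extending a given cycle on `ZMod k` -/
lemma fiber_sum (A : Set ℕ) (k : ℕ) (hk : k ∈ A) (β : Type) :
    Nat.card {σ : Equiv.Perm (ZMod k ⊕ β) // (∀ i, minimalPeriod (⇑σ) i ∈ A) ∧
      ∀ i : ZMod k, σ (Sum.inl i) = Sum.inl (i + 1)} = cnt A β := by
  symm
  refine Nat.card_congr (Equiv.ofBijective
    (fun τ => ⟨Equiv.sumCongr (Equiv.addRight (1 : ZMod k)) τ.1, ?_, ?_⟩) ⟨?_, ?_⟩)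
  · rintro (i | b)
    · rw [mp_semiconj (fun j : ZMod k => j + 1) _ Sum.inl Sum.inl_injective (by simp), mp_add_one]
      exact hk
    · rw [mp_semiconj τ.1 _ Sum.inr Sum.inr_injective (by simp)]
      exact τ.2 b
  · simp
  · intro τ τ' h
    ext b
    have := congrArg (fun s => s.1 (Sum.inr b)) h
    simpa using this
  · rintro ⟨σ, h1, h2⟩
    have hr : ∀ b, ∃ b', σ (Sum.inr b) = Sum.inr b' := by
      intro b
      rcases h : σ (Sum.inr b) with i | b'
      · have := h2 (i - 1)
        rw [sub_add_cancel, ← h] at this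
        simpa using σ.injective this
      · exact ⟨b', rfl⟩
    have hr' : ∀ b, ∃ b', σ (Sum.inr b') = Sum.inr b := by
      intro b
      rcases h : σ.symm (Sum.inr b) with i | b'
      · have := h2 i
        rw [← h] at this
        simp at this
      · exact ⟨b', by rw [← h]; simp⟩
    choose f hf using hr
    have hfb : Bijective f := by
      constructor
      · intro x y hxy
        have : σ (Sum.inr x) = σ (Sum.inr y) := by rw [hf, hf, hxy]
        simpa using σ.injective this
      · intro b
        obtain ⟨b', hb'⟩ := hr' b
        refine ⟨b', ?_⟩
        rw [hf] at hb'
        simpa using hb'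
    refine ⟨⟨Equiv.ofBijective f hfb, ?_⟩, ?_⟩
    · intro b
      have := mp_semiconj f σ Sum.inr Sum.inr_injective (fun x => (hf x).symm) b
      have h3 := h1 (Sum.inr b)
      rw [this] at h3
      exact h3
    · apply Subtype.ext
      ext1 x
      rcases x with i | b
      · simp [h2]
      · simp [hf]

lemma fiber (A : Set ℕ) (k : ℕ) (hk : k ∈ A) (α : Type) [Finite α] [NeZero k] (e : ZMod k ↪ α) :
    Nat.card {σ : Equiv.Perm α // (∀ i, minimalPeriod (⇑σ) i ∈ A) ∧
      ∀ i : ZMod k, σ (e i) = e (i + 1)} = cnt A (Fin (Nat.card α - k)) := by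
  classical
  let β := {x // x ∈ (Set.range e)ᶜ}
  have : Fintype α := Fintype.ofFinite α
  have hβ : Nat.card β = Nat.card α - k := by
    have h1 : Nat.card (ZMod k ⊕ β) = Nat.card α :=
      Nat.card_congr ((Equiv.sumCongr (Equiv.ofInjective e e.injective) (Equiv.refl _)).trans
        (Equiv.Set.sumCompl (Set.range e)))
    rw [Nat.card_sum, Nat.card_zmod] at h1
    omega
  let φ : ZMod k ⊕ β ≃ α := (Equiv.sumCongr (Equiv.ofInjective e e.injective) (Equiv.refl _)).trans
        (Equiv.Set.sumCompl (Set.range e))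
  have hφ : ∀ i, φ (Sum.inl i) = e i := by intro i; rfl
  rw [← hβ, cnt_congr A (Finite.equivFin β).symm, ← fiber_sum A k hk β]
  symm
  refine Nat.card_congr (Equiv.subtypeEquiv φ.permCongr fun σ => and_congr ?_ ?_)
  · constructor
    · intro h i
      have := mp_semiconj σ (φ.permCongr σ) φ φ.injective (by simp) (φ.symm i)
      rw [φ.apply_symm_apply] at this
      rw [this]; exact h _
    · intro h i
      have := mp_semiconj σ (φ.permCongr σ) φ φ.injective (by simp) i
      rw [← this]; exact h _
  · refine forall_congr' fun i => ?_
    rw [← hφ, ← hφ, Equiv.permCongr_apply, Equiv.symm_apply_apply]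
    simp

lemma card_emb_fix (α : Type) [Finite α] (k : ℕ) [NeZero k] (a : α) :
    Nat.card α * Nat.card {e : ZMod k ↪ α // e 0 = a} = (Nat.card α).descFactorial k := by
  classical
  have : Fintype α := Fintype.ofFinite α
  have h1 : Nat.card (ZMod k ↪ α) = (Nat.card α).descFactorial k := by
    rw [Nat.card_eq_fintype_card, Fintype.card_embedding_eq, ZMod.card, Nat.card_eq_fintype_card]
  have h2 : ∀ b : α, Nat.card {e : ZMod k ↪ α // e 0 = b} = Nat.card {e : ZMod k ↪ α // e 0 = a} := by
    intro b
    refine Nat.card_congr (Equiv.subtypeEquiv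
      (Equiv.embeddingCongr (Equiv.refl _) (Equiv.swap a b)) fun e => ?_)
    simp [Equiv.swap_apply_eq_iff]
  rw [← h1, Nat.card_congr (Equiv.sigmaFiberEquiv (fun e : ZMod k ↪ α => e 0)).symm, Nat.card_sigma]
  rw [Finset.sum_congr rfl (fun b _ => h2 b), Finset.sum_const, Finset.card_univ, smul_eq_mul,
    Nat.card_eq_fintype_card (α := α)]

lemma card_cycle (A : Set ℕ) (k : ℕ) (hk : k ∈ A) (α : Type) [Finite α] [NeZero k] (a : α) :
    Nat.card {σ : Equiv.Perm α // (∀ i, minimalPeriod (⇑σ) i ∈ A) ∧ minimalPeriod (⇑σ) a = k} =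
      Nat.card {e : ZMod k ↪ α // e 0 = a} * cnt A (Fin (Nat.card α - k)) := by
  classical
  have : Fintype α := Fintype.ofFinite α
  have : Fintype (ZMod k ↪ α) := Fintype.ofFinite _
  let T : {e : ZMod k ↪ α // e 0 = a} → Type := fun e =>
    {σ : Equiv.Perm α // (∀ i, minimalPeriod (⇑σ) i ∈ A) ∧ ∀ i : ZMod k, σ (e.1 i) = e.1 (i + 1)}
  have hT : Nat.card (Σ e, T e) =
      Nat.card {e : ZMod k ↪ α // e 0 = a} * cnt A (Fin (Nat.card α - k)) := by
    rw [Nat.card_sigma, Finset.sum_congr rfl (fun e _ => fiber A k hk α e.1)]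
    simp
  rw [← hT]
  symm
  refine Nat.card_congr (Equiv.ofBijective
    (fun p => ⟨p.2.1, p.2.2.1, ?_⟩) ⟨?_, ?_⟩)
  · obtain ⟨⟨e, he⟩, ⟨σ, h1, h2⟩⟩ := p
    change minimalPeriod σ a = k
    have h2 : ∀ i : ZMod k, σ (e i) = e (i + 1) := h2
    rw [← he, mp_semiconj (fun j : ZMod k => j + 1) σ e e.injective (fun i => (h2 i).symm), mp_add_one]
  · rintro ⟨⟨e, he⟩, ⟨σ, h1, h2⟩⟩ ⟨⟨e', he'⟩, ⟨σ', h1', h2'⟩⟩ h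
    have hσ : σ = σ' := by simpa using h
    subst hσ
    have : e = e' := by
      ext i
      have : ∀ n : ℕ, e n = e' n := by
        intro n
        induction n with
        | zero => simp [he, he']
        | succ n ih => push_cast; rw [← h2, ← h2', ih]
      rw [← ZMod.natCast_zmod_val i]
      exact this _
    subst this
    rfl
  · rintro ⟨σ, h1, h2⟩
    have hinj : Injective (fun i : ZMod k => σ^[i.val] a) := by
      intro i j hij
      have := iterate_injOn_Iio_minimalPeriod (f := σ) (x := a)
      rw [h2] at this
      exact ZMod.val_injective k (this (ZMod.val_lt i) (ZMod.val_lt j) hij)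
    have hstep : ∀ i : ZMod k, σ (σ^[i.val] a) = σ^[(i + 1).val] a := by
      intro i
      rw [← iterate_succ_apply' σ, ZMod.val_add, ZMod.val_one_eq_one_mod]
      have h := iterate_mod_minimalPeriod_eq (f := σ) (x := a) (n := i.val + 1)
      rw [h2] at h
      rw [Nat.add_mod_mod, h]
    exact ⟨⟨⟨⟨fun i => σ^[i.val] a, hinj⟩, by simp⟩, ⟨σ, h1, hstep⟩⟩, rfl⟩

lemma cnt_zero (A : Set ℕ) : cnt A (Fin 0) = 1 := by
  rw [cnt, Nat.card_eq_one_iff_unique]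
  exact ⟨⟨fun x y => Subtype.ext (Subsingleton.elim _ _)⟩, ⟨⟨1, fun i => i.elim0⟩⟩⟩

lemma cnt_rec (A : Finset ℕ) (α : Type) [Finite α] (a : α) :
    cnt A α = ∑ k ∈ A, Nat.card {σ : Equiv.Perm α //
      (∀ i, minimalPeriod (⇑σ) i ∈ (A : Set ℕ)) ∧ minimalPeriod (⇑σ) a = k} := by
  classical
  have : Fintype α := Fintype.ofFinite α
  have : Fintype (Equiv.Perm α) := Fintype.ofFinite _
  simp only [cnt, Nat.card_eq_fintype_card, Fintype.card_subtype]
  rw [Finset.card_eq_sum_card_fiberwise (f := fun σ : Equiv.Perm α => minimalPeriod (⇑σ) a) (t := A)]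
  · simp [Finset.filter_filter]
  · intro σ hσ
    simp at hσ
    exact hσ a

def uu (A : Set ℕ) (n : ℕ) : ℝ := cnt A (Fin n) / n.factorial

lemma card_cycle_real (A : Set ℕ) (k : ℕ) (hk : k ∈ A) (hk0 : 0 < k) (n : ℕ) (hn : 0 < n)
    (a : Fin n) :
    (Nat.card {σ : Equiv.Perm (Fin n) // (∀ i, minimalPeriod (⇑σ) i ∈ A) ∧ minimalPeriod (⇑σ) a = k} : ℝ)
      = n.factorial / n * (if k ≤ n then uu A (n - k) else 0) := by
  have : NeZero k := ⟨hk0.ne'⟩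
  rw [card_cycle A k hk]
  have h := card_emb_fix (Fin n) k a
  rw [Nat.card_fin] at h ⊢
  have hn' : (n : ℝ) ≠ 0 := by exact_mod_cast hn.ne'
  split_ifs with hkn
  · have h3 := Nat.factorial_mul_descFactorial hkn
    rw [← h] at h3
    rw [← h3, uu]
    have := Nat.factorial_ne_zero (n - k)
    push_cast
    field_simp
  · rw [Nat.descFactorial_of_lt (by omega)] at h
    have : Nat.card {e : ZMod k ↪ Fin n // e 0 = a} = 0 := by
      rcases Nat.mul_eq_zero.1 h with h | h
      · omega
      · exact h
    rw [this]; simp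

lemma uu_zero (A : Set ℕ) : uu A 0 = 1 := by simp [uu, cnt_zero]

lemma uu_rec (A : Finset ℕ) (hpos : ∀ a ∈ A, 0 < a) (n : ℕ) (hn : 0 < n) :
    (n : ℝ) * uu A n = ∑ k ∈ A, if k ≤ n then uu A (n - k) else 0 := by
  have h := cnt_rec A (Fin n) ⟨0, hn⟩
  have h2 : (cnt A (Fin n) : ℝ) = ∑ k ∈ A, (n.factorial : ℝ) / n * (if k ≤ n then uu A (n - k) else 0) := by
    rw [h]; push_cast
    exact Finset.sum_congr rfl fun k hk => card_cycle_real A k hk (hpos k hk) n hn _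
  rw [← Finset.mul_sum] at h2
  have hn' : (n : ℝ) ≠ 0 := by exact_mod_cast hn.ne'
  have := Nat.factorial_ne_zero n
  rw [uu, h2]
  field_simp

end Comb

def FF (B : Finset ℕ) (c : ℝ) (z : ℂ) : ℂ := Complex.exp (∑ k ∈ B, z ^ k / ((c : ℂ) * k))

lemma FF_diff (B : Finset ℕ) (c : ℝ) : Differentiable ℂ (FF B c) := by
  unfold FF
  fun_prop

lemma FF_deriv (B : Finset ℕ) (hB : ∀ b ∈ B, 0 < b) (c : ℝ) (hc : 0 < c) (z : ℂ) :
    HasDerivAt (FF B c) (FF B c z * ∑ k ∈ B, z ^ (k - 1) / c) z := by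
  unfold FF
  apply HasDerivAt.cexp
  apply HasDerivAt.fun_sum
  intro k hk
  have h := (hasDerivAt_pow k z).div_const ((c : ℂ) * k)
  have h1 : (k : ℂ) ≠ 0 := by exact_mod_cast (hB k hk).ne'
  have h2 : (c : ℂ) ≠ 0 := by exact_mod_cast hc.ne'
  have e : z ^ (k - 1) / (c : ℂ) = (k : ℂ) * z ^ (k - 1) / ((c : ℂ) * k) := by
    field_simp
  rw [e]
  exact h

def JJ (B : Finset ℕ) (c R : ℝ) (n : ℤ) : ℂ := ∮ z in C(0, R), FF B c z * z ^ (-n - 1)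

lemma JJ_neg (B : Finset ℕ) (c R : ℝ) (hR : 0 < R) (n : ℤ) (hn : n < 0) : JJ B c R n = 0 := by
  obtain ⟨m, hm⟩ : ∃ m : ℕ, -n - 1 = m := ⟨(-n - 1).toNat, by omega⟩
  unfold JJ
  simp only [hm, zpow_natCast]
  have hd : Differentiable ℂ (fun z => FF B c z * z ^ m) := (FF_diff B c).mul (by fun_prop)
  exact Complex.circleIntegral_eq_zero_of_differentiable_on_off_countable hR.le Set.countable_empty
    hd.continuous.continuousOn (fun z _ => hd z)

lemma JJ_zero (B : Finset ℕ) (hB : ∀ b ∈ B, 0 < b) (c R : ℝ) (hR : 0 < R) :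
    JJ B c R 0 = 2 * Real.pi * Complex.I := by
  unfold JJ
  have h := Complex.circleIntegral_sub_inv_smul_of_differentiable_on_off_countable
    (R := R) (c := 0) (w := 0) (f := FF B c) Set.countable_empty (by simpa using hR)
    (FF_diff B c).continuous.continuousOn (fun z _ => FF_diff B c z)
  have h0 : FF B c 0 = 1 := by
    unfold FF
    rw [Finset.sum_eq_zero]; · simp
    intro k hk
    simp [(hB k hk).ne']
  rw [h0] at h
  simp only [sub_zero, smul_eq_mul, mul_one] at h
  rw [← h]
  congr 1; ext z
  rw [neg_zero, zero_sub, zpow_neg_one, mul_comm]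

lemma JJ_int (B : Finset ℕ) (c R : ℝ) (hR : 0 < R) (n : ℤ) :
    CircleIntegrable (fun z => FF B c z * z ^ n) 0 R := by
  apply ContinuousOn.circleIntegrable hR.le
  apply (FF_diff B c).continuous.continuousOn.mul
  intro z hz
  apply ContinuousAt.continuousWithinAt
  apply continuousAt_zpow₀
  left
  rintro rfl
  simp at hz
  exact hR.ne hz

lemma JJ_rec (B : Finset ℕ) (hB : ∀ b ∈ B, 0 < b) (c : ℝ) (hc : 0 < c) (R : ℝ) (hR : 0 < R) (n : ℤ) :
    (c : ℂ) * n * JJ B c R n = ∑ k ∈ B, JJ B c R (n - k) := by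
  have hc' : (c : ℂ) ≠ 0 := by exact_mod_cast hc.ne'
  have h0 : ∀ z ∈ Metric.sphere (0 : ℂ) R, z ≠ 0 := by
    rintro z hz rfl
    simp at hz
    exact hR.ne hz
  have key := circleIntegral.integral_eq_zero_of_hasDerivWithinAt (c := 0) (R := R)
    (f := fun z => FF B c z * z ^ (-n))
    (f' := fun z => FF B c z * (∑ k ∈ B, z ^ (k - 1) / c) * z ^ (-n)
      + FF B c z * (((-n : ℤ) : ℂ) * z ^ (-n - 1))) hR.le
    (fun z hz => ((FF_deriv B hB c hc z).mul
      (hasDerivAt_zpow (-n) z (Or.inl (h0 z hz)))).hasDerivWithinAt)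
  have e : (∮ z in C(0, R), ∑ k ∈ B, (FF B c z * z ^ (-(n - k) - 1)) - (c : ℂ) * n * (FF B c z * z ^ (-n - 1))) =
      ∮ z in C(0, R), (c : ℂ) * (FF B c z * (∑ k ∈ B, z ^ (k - 1) / c) * z ^ (-n)
      + FF B c z * (((-n : ℤ) : ℂ) * z ^ (-n - 1))) := by
    apply circleIntegral.integral_congr hR.le
    intro z hz
    have hz0 := h0 z hz
    simp only
    have : ∑ k ∈ B, (FF B c z * z ^ (-(n - k) - 1)) =
        c * (FF B c z * (∑ k ∈ B, z ^ (k - 1) / c) * z ^ (-n)) := by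
      rw [Finset.mul_sum, Finset.sum_mul, Finset.mul_sum]
      refine Finset.sum_congr rfl fun k hk => ?_
      have : z ^ (-(n - k) - 1) = z ^ (k - 1) * z ^ (-n) := by
        rw [← zpow_natCast, ← zpow_add₀ hz0, Nat.cast_sub (hB k hk)]
        congr 1; push_cast; ring
      rw [this]
      field_simp
    rw [this]
    push_cast; ring
  rw [circleIntegral.integral_const_mul, key, mul_zero, circleIntegral.integral_sub,
    circleIntegral.integral_fun_sum, circleIntegral.integral_const_mul, sub_eq_zero] at e
  · exact e.symm
  · intro k hk
    exact JJ_int B c R hR _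
  · apply CircleIntegrable.fun_sum
    intro k hk
    exact JJ_int B c R hR _
  · exact (JJ_int B c R hR _).const_smul (a := (c : ℂ) * n)

lemma JJ_eq (B : Finset ℕ) (hB : ∀ b ∈ B, 0 < b) (c : ℝ) (hc : 0 < c) (u : ℕ → ℝ) (hu0 : u 0 = 1)
    (hu : ∀ n : ℕ, 0 < n → c * n * u n = ∑ k ∈ B, if k ≤ n then u (n - k) else 0)
    (R : ℝ) (hR : 0 < R) (n : ℕ) : JJ B c R n = 2 * Real.pi * Complex.I * u n := by
  induction n using Nat.strong_induction_on with
  | _ n ih =>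
    rcases Nat.eq_zero_or_pos n with rfl | hn
    · simp [JJ_zero B hB c R hR, hu0]
    · have h := JJ_rec B hB c hc R hR n
      have hc' : (c : ℂ) ≠ 0 := by exact_mod_cast hc.ne'
      have hn' : (n : ℂ) ≠ 0 := by exact_mod_cast hn.ne'
      have h2 : ∑ k ∈ B, JJ B c R (n - k) = 2 * Real.pi * Complex.I *
          ((∑ k ∈ B, if k ≤ n then u (n - k) else 0 : ℝ) : ℂ) := by
        push_cast
        rw [Finset.mul_sum]
        refine Finset.sum_congr rfl fun k hk => ?_
        split_ifs with hkn
        · rw [← ih (n - k) (by have := hB k hk; omega), Nat.cast_sub hkn]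
        · rw [JJ_neg B c R hR _ (by omega)]; simp
      rw [h2, ← hu n hn] at h
      push_cast at h
      have hcn : (c : ℂ) * n ≠ 0 := mul_ne_zero hc' hn'
      apply mul_left_cancel₀ hcn
      rw [h]; ring

lemma JJ_theta (B : Finset ℕ) (c R : ℝ) (hR : 0 < R) (n : ℤ) :
    JJ B c R n = Complex.I * (R : ℂ) ^ (-n) *
      ∫ θ in (-Real.pi)..Real.pi, FF B c (R * Complex.exp (θ * Complex.I)) * Complex.exp (-n * θ * Complex.I) := by
  have hR' : (R : ℂ) ≠ 0 := by exact_mod_cast hR.ne'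
  have hper : Function.Periodic (fun θ : ℝ => FF B c (R * Complex.exp (θ * Complex.I)) * Complex.exp (-n * θ * Complex.I)) (2 * Real.pi) := by
    intro θ
    simp only
    congr 1
    · congr 2
      rw [Complex.exp_eq_exp_iff_exists_int]
      exact ⟨1, by push_cast; ring⟩
    · rw [Complex.exp_eq_exp_iff_exists_int]
      exact ⟨-n, by push_cast; ring⟩
  have h1 := hper.intervalIntegral_add_eq (-Real.pi) 0
  rw [show -Real.pi + 2 * Real.pi = Real.pi by ring, zero_add] at h1
  rw [h1, ← intervalIntegral.integral_const_mul]
  unfold JJ circleIntegral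
  apply intervalIntegral.integral_congr
  intro θ _
  simp only [deriv_circleMap, circleMap, zero_add, smul_eq_mul]
  have he : Complex.exp (θ * Complex.I) ≠ 0 := Complex.exp_ne_zero _
  rw [show -(n : ℂ) * θ * Complex.I = ((-n : ℤ) : ℂ) * (θ * Complex.I) by push_cast; ring, Complex.exp_int_mul,
    mul_zpow, zpow_sub_one₀ hR', zpow_sub_one₀ he]
  field_simp

def PhiF (B : Finset ℕ) (c R θ : ℝ) : ℂ :=
  ∑ k ∈ B, ((R ^ k / (c * k) : ℝ) : ℂ) *
    (Complex.exp ((k * θ : ℝ) * Complex.I) - 1 - (k * θ : ℝ) * Complex.I)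

lemma u_formula (B : Finset ℕ) (hB : ∀ b ∈ B, 0 < b) (c : ℝ) (hc : 0 < c) (u : ℕ → ℝ) (hu0 : u 0 = 1)
    (hu : ∀ n : ℕ, 0 < n → c * n * u n = ∑ k ∈ B, if k ≤ n then u (n - k) else 0)
    (R : ℝ) (hR : 0 < R) (n : ℕ) (hn : ∑ k ∈ B, R ^ k = c * n) (j : ℕ) (hj : j ≤ n) :
    (u (n - j) : ℂ) = FF B c R * (R : ℂ) ^ j / (R : ℂ) ^ n / (2 * Real.pi) *
      ∫ θ in (-Real.pi)..Real.pi, Complex.exp (PhiF B c R θ) * Complex.exp (j * θ * Complex.I) := by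
  have h := JJ_eq B hB c hc u hu0 hu R hR (n - j)
  rw [JJ_theta B c R hR] at h
  have hR' : (R : ℂ) ≠ 0 := by exact_mod_cast hR.ne'
  have hc' : (c : ℂ) ≠ 0 := by exact_mod_cast hc.ne'
  have hnc : (n : ℂ) = ∑ k ∈ B, (R : ℂ) ^ k / c := by
    rw [← Finset.sum_div, eq_div_iff hc', mul_comm]
    exact_mod_cast hn.symm
  have e : ∀ θ : ℝ, FF B c (R * Complex.exp (θ * Complex.I)) * Complex.exp (-((n - j : ℕ) : ℤ) * θ * Complex.I)
      = FF B c R * (Complex.exp (PhiF B c R θ) * Complex.exp (j * θ * Complex.I)) := by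
    intro θ
    unfold FF PhiF
    rw [← Complex.exp_add, ← Complex.exp_add, ← Complex.exp_add]
    congr 1
    rw [← add_assoc, ← Finset.sum_add_distrib]
    have : -(((n - j : ℕ) : ℤ) : ℂ) * θ * Complex.I = -(∑ k ∈ B, (R : ℂ) ^ k / c * θ * Complex.I) + j * θ * Complex.I := by
      rw [← Finset.sum_mul, ← Finset.sum_mul, ← hnc]
      push_cast [Nat.cast_sub hj]
      ring
    rw [this, ← add_assoc, ← sub_eq_add_neg, ← Finset.sum_sub_distrib]
    congr 1
    refine Finset.sum_congr rfl fun k hk => ?_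
    have : (k : ℂ) ≠ 0 := by exact_mod_cast (hB k hk).ne'
    rw [mul_pow, ← Complex.exp_nat_mul]
    push_cast
    rw [← mul_assoc]
    field_simp
    ring
  simp only [Int.cast_natCast] at e h
  simp only [e] at h
  rw [intervalIntegral.integral_const_mul] at h
  rw [zpow_neg, zpow_natCast] at h
  have hp : (R : ℂ) ^ n = R ^ (n - j) * R ^ j := by rw [← pow_add]; congr 1; omega
  have hpi : (Real.pi : ℂ) ≠ 0 := by exact_mod_cast Real.pi_ne_zero
  have hI := Complex.I_ne_zero
  rw [hp]
  apply mul_left_cancel₀ (mul_ne_zero (mul_ne_zero two_ne_zero hpi) hI)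
  rw [← h]
  field_simp

lemma PhiF_re (B : Finset ℕ) (c R θ : ℝ) :
    (PhiF B c R θ).re = -∑ k ∈ B, R ^ k / (c * k) * (1 - Real.cos (k * θ)) := by
  unfold PhiF
  rw [Complex.re_sum, ← Finset.sum_neg_distrib]
  refine Finset.sum_congr rfl fun k hk => ?_
  rw [Complex.re_ofReal_mul, Complex.sub_re, Complex.sub_re, Complex.exp_ofReal_mul_I_re]
  simp
  ring

lemma PhiF_cont (B : Finset ℕ) (c R : ℝ) : Continuous (PhiF B c R) := by
  unfold PhiF
  fun_prop

lemma norm_integrand (B : Finset ℕ) (c R θ : ℝ) (j : ℕ) :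
    ‖Complex.exp (PhiF B c R θ) * Complex.exp (j * θ * Complex.I)‖ =
      Real.exp (-∑ k ∈ B, R ^ k / (c * k) * (1 - Real.cos (k * θ))) := by
  rw [norm_mul, Complex.norm_exp, PhiF_re]
  have : (j : ℂ) * θ * Complex.I = ((j * θ : ℝ) : ℂ) * Complex.I := by push_cast; ring
  rw [this, Complex.norm_exp_ofReal_mul_I, mul_one]

lemma far_bound (B : Finset ℕ) (hB : ∀ b ∈ B, 0 < b) (hg : B.gcd id = 1) (c : ℝ) (hc : 0 < c)
    (δ : ℝ) (hδ : 0 < δ) :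
    ∃ η > 0, ∀ R : ℝ, 1 ≤ R → ∀ θ : ℝ, δ ≤ |θ| → |θ| ≤ Real.pi →
      η * R ≤ ∑ k ∈ B, R ^ k / (c * k) * (1 - Real.cos (k * θ)) := by
  let g : ℝ → ℝ := fun θ => ∑ k ∈ B, 1 / (c * k) * (1 - Real.cos (k * θ))
  have hgc : Continuous g := by
    simp only [g]
    fun_prop
  let K : Set ℝ := {θ | δ ≤ |θ| ∧ |θ| ≤ Real.pi}
  have hK : IsCompact K := by
    have : K = Set.Icc (-Real.pi) Real.pi ∩ {θ | δ ≤ |θ|} := by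
      ext θ; simp [K, abs_le]; tauto
    rw [this]
    exact isCompact_Icc.inter_right (isClosed_le continuous_const continuous_abs)
  have hterm : ∀ k ∈ B, ∀ θ, 0 ≤ 1 / (c * k) * (1 - Real.cos (k * θ)) := by
    intro k hk θ
    have := Real.cos_le_one (k * θ)
    exact mul_nonneg (by positivity) (by linarith)
  have hpos : ∀ θ ∈ K, 0 < g θ := by
    intro θ hθ
    apply lt_of_le_of_ne (Finset.sum_nonneg fun k hk => hterm k hk θ)
    intro h0
    have h1 := (Finset.sum_eq_zero_iff_of_nonneg (fun k hk => hterm k hk θ)).1 h0.symm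
    have h2 : ∀ k ∈ B, Complex.exp (θ * Complex.I) ^ k = 1 := by
      intro k hk
      have h3 := h1 k hk
      have hk0 : (k : ℝ) ≠ 0 := by exact_mod_cast (hB k hk).ne'
      have h4 : Real.cos (k * θ) = 1 := by
        rcases mul_eq_zero.1 h3 with h | h
        · exact absurd h (by positivity)
        · linarith
      obtain ⟨m, hm⟩ := (Real.cos_eq_one_iff _).1 h4
      rw [← Complex.exp_nat_mul, Complex.exp_eq_one_iff]
      refine ⟨m, ?_⟩
      have : (k : ℂ) * θ = m * (2 * Real.pi) := by exact_mod_cast hm.symm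
      rw [← mul_assoc, this]; ring
    have h3 : orderOf (Complex.exp (θ * Complex.I)) ∣ B.gcd id :=
      Finset.dvd_gcd fun k hk => orderOf_dvd_of_pow_eq_one (h2 k hk)
    rw [hg, Nat.dvd_one, orderOf_eq_one_iff, Complex.exp_eq_one_iff] at h3
    obtain ⟨m, hm⟩ := h3
    have hm' : θ = m * (2 * Real.pi) := by
      have : (θ : ℂ) = m * (2 * Real.pi) := by
        apply mul_right_cancel₀ Complex.I_ne_zero
        rw [hm]; ring
      exact_mod_cast this
    have hpi := Real.pi_pos
    have hm0 : m ≠ 0 := by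
      rintro rfl
      have := hθ.1
      simp [hm'] at this
      linarith
    have hm1 : (1 : ℝ) ≤ |(m : ℝ)| := by exact_mod_cast Int.one_le_abs hm0
    have := hθ.2
    rw [hm', abs_mul, abs_of_pos (by positivity : 0 < 2 * Real.pi)] at this
    nlinarith
  obtain ⟨η, hη, hη2⟩ : ∃ η > 0, ∀ θ ∈ K, η ≤ g θ := by
    rcases K.eq_empty_or_nonempty with h | h
    · exact ⟨1, one_pos, by simp [h]⟩
    · obtain ⟨θ0, h0, hm⟩ := hK.exists_isMinOn h hgc.continuousOn
      exact ⟨g θ0, hpos θ0 h0, fun θ hθ => hm hθ⟩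
  refine ⟨η, hη, fun R hR θ h1 h2 => ?_⟩
  calc η * R ≤ g θ * R := by
        have := hη2 θ ⟨h1, h2⟩
        nlinarith
    _ = ∑ k ∈ B, R * (1 / (c * k) * (1 - Real.cos (k * θ))) := by
        simp only [g]; rw [mul_comm, Finset.mul_sum]
    _ ≤ _ := by
        refine Finset.sum_le_sum fun k hk => ?_
        have : R ≤ R ^ k := le_self_pow₀ hR (hB k hk).ne'
        have h3 := mul_le_mul_of_nonneg_right this (hterm k hk θ)
        calc _ ≤ _ := h3
          _ = _ := by ring

lemma PhiF_lim (B : Finset ℕ) (hB : ∀ b ∈ B, 0 < b) (c : ℝ) (hc : 0 < c)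
    (d : ℕ) (hd : d ∈ B) (hmax : ∀ b ∈ B, b ≤ d) (s : ℝ) :
    Tendsto (fun y : ℝ => PhiF B c (y ^ 2) (s / y ^ d)) atTop
      (𝓝 ((-(d / (2 * c)) * s ^ 2 : ℝ) : ℂ)) := by
  have hd0 : 0 < d := hB d hd
  have hsum : ((-(d / (2 * c)) * s ^ 2 : ℝ) : ℂ) =
      ∑ k ∈ B, if k = d then ((-(d / (2 * c)) * s ^ 2 : ℝ) : ℂ) else 0 := by
    rw [Finset.sum_ite_eq' B d]; simp [hd]
  rw [hsum]
  unfold PhiF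
  apply tendsto_finsetSum
  intro k hk
  have hk0 := hB k hk
  have hkd := hmax k hk
  have hkr : (0 : ℝ) < k := by exact_mod_cast hk0
  -- main part
  have hmain : Tendsto (fun y : ℝ => (((y ^ 2) ^ k / (c * k) * (-(k * (s / y ^ d)) ^ 2 / 2) : ℝ) : ℂ)) atTop
      (𝓝 (if k = d then ((-(d / (2 * c)) * s ^ 2 : ℝ) : ℂ) else 0)) := by
    split_ifs with h
    · subst h
      apply Tendsto.congr' _ tendsto_const_nhds
      filter_upwards [eventually_gt_atTop 0] with y hy
      congr 1
      field_simp
      ring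
    · have hlt : k < d := lt_of_le_of_ne hkd h
      rw [← Complex.ofReal_zero]
      apply (Complex.continuous_ofReal.tendsto 0).comp
      have h1 : Tendsto (fun y : ℝ => (-(k * s ^ 2) / (2 * c)) * (y ^ (2 * (d - k)))⁻¹) atTop (𝓝 0) := by
        have h2 : Tendsto (fun y : ℝ => (y ^ (2 * (d - k)))⁻¹) atTop (𝓝 0) :=
          tendsto_inv_atTop_zero.comp (tendsto_pow_atTop (by omega))
        simpa using h2.const_mul (-((k : ℝ) * s ^ 2) / (2 * c))
      apply h1.congr'
      filter_upwards [eventually_gt_atTop 0] with y hy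
      have : y ^ d = y ^ k * y ^ (d - k) := by rw [← pow_add]; congr 1; omega
      rw [this, pow_mul]
      field_simp
      ring
  have herr : Tendsto (fun y : ℝ => (((y ^ 2) ^ k / (c * k) : ℝ) : ℂ) *
      (Complex.exp ((k * (s / y ^ d) : ℝ) * Complex.I) - 1 - (k * (s / y ^ d) : ℝ) * Complex.I
        - ((-(k * (s / y ^ d)) ^ 2 / 2 : ℝ) : ℂ))) atTop (𝓝 0) := by
    have h1 : Tendsto (fun y : ℝ => (k ^ 2 * |s| ^ 3 / c) * (y ^ (3 * d - 2 * k))⁻¹) atTop (𝓝 0) := by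
      rw [← mul_zero ((k : ℝ) ^ 2 * |s| ^ 3 / c)]
      exact (tendsto_inv_atTop_zero.comp (tendsto_pow_atTop (by omega))).const_mul _
    apply squeeze_zero_norm' _ h1
    have h2 : Tendsto (fun y : ℝ => |k * s| * (y ^ d)⁻¹) atTop (𝓝 0) := by
      rw [← mul_zero |k * s|]
      exact (tendsto_inv_atTop_zero.comp (tendsto_pow_atTop (by omega))).const_mul _
    filter_upwards [eventually_gt_atTop 0, h2.eventually (ge_mem_nhds one_pos)] with y hy hy2
    have hyd : 0 < y ^ d := by positivity
    set φ : ℝ := k * (s / y ^ d) with hφ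
    have hφ1 : |φ| = |k * s| * (y ^ d)⁻¹ := by
      rw [hφ, ← mul_div_assoc, abs_div, abs_of_pos hyd]; rfl
    have hn : ‖(φ : ℂ) * Complex.I‖ = |φ| := by simp
    have hb := Complex.exp_bound (x := (φ : ℂ) * Complex.I) (by rw [hn, hφ1]; exact hy2) (n := 3) (by norm_num)
    rw [hn] at hb
    have e1 : Complex.exp (φ * Complex.I) - 1 - φ * Complex.I - ((-φ ^ 2 / 2 : ℝ) : ℂ) =
        Complex.exp (φ * Complex.I) - ∑ m ∈ Finset.range 3, ((φ : ℂ) * Complex.I) ^ m / (m.factorial : ℂ) := by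
      simp [Finset.sum_range_succ, mul_pow]
      ring
    rw [e1, norm_mul, Complex.norm_real, Real.norm_of_nonneg (by positivity)]
    have hb2 : ‖Complex.exp (φ * Complex.I) - ∑ m ∈ Finset.range 3, ((φ : ℂ) * Complex.I) ^ m / (m.factorial : ℂ)‖ ≤ |φ| ^ 3 := by
      refine hb.trans ?_
      have : (0 : ℝ) ≤ |φ| ^ 3 := by positivity
      norm_num [Nat.factorial]
      nlinarith
    refine (mul_le_mul_of_nonneg_left hb2 (by positivity)).trans (le_of_eq ?_)
    have e2 : y ^ (3 * d) = y ^ (3 * d - 2 * k) * y ^ (2 * k) := by rw [← pow_add]; congr 1; omega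
    rw [hφ1, abs_mul, abs_of_pos hkr, mul_pow, inv_pow, ← pow_mul, ← pow_mul, mul_comm d 3, e2]
    field_simp
  have := hmain.add herr
  rw [add_zero] at this
  refine this.congr fun y => ?_
  push_cast
  ring

lemma II_tendsto (B : Finset ℕ) (hB : ∀ b ∈ B, 0 < b) (hg : B.gcd id = 1) (c : ℝ) (hc : 0 < c)
    (d : ℕ) (hd : d ∈ B) (hmax : ∀ b ∈ B, b ≤ d) (j : ℕ) :
    Tendsto (fun y : ℝ => ((y ^ d : ℝ) : ℂ) * ∫ θ in (-Real.pi)..Real.pi,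
        Complex.exp (PhiF B c (y ^ 2) θ) * Complex.exp (j * θ * Complex.I)) atTop
      (𝓝 ((√(Real.pi / (d / (2 * c))) : ℝ) : ℂ)) := by
  have hd0 : 0 < d := hB d hd
  have hdr : (0 : ℝ) < d := by exact_mod_cast hd0
  have hpi := Real.pi_pos
  set δ := Real.pi / d with hδ
  have hδ0 : 0 < δ := by positivity
  have hδ1 : δ ≤ Real.pi := div_le_self hpi.le (by exact_mod_cast hd0)
  obtain ⟨η, hη, hfar⟩ := far_bound B hB hg c hc δ hδ0
  let g : ℝ → ℝ → ℂ := fun y θ => Complex.exp (PhiF B c (y ^ 2) θ) * Complex.exp (j * θ * Complex.I)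
  have hgcont : ∀ y, Continuous (g y) := by
    intro y
    have := PhiF_cont B c (y ^ 2)
    simp only [g]
    fun_prop
  have hgi : ∀ y a b, IntervalIntegrable (g y) MeasureTheory.volume a b :=
    fun y a b => (hgcont y).intervalIntegrable a b
  -- outer pieces
  have hout : ∀ a b : ℝ, (∀ θ ∈ Set.uIoc a b, δ ≤ |θ| ∧ |θ| ≤ Real.pi) →
      Tendsto (fun y : ℝ => ((y ^ d : ℝ) : ℂ) * ∫ θ in a..b, g y θ) atTop (𝓝 0) := by
    intro a b hab
    have h1 : Tendsto (fun y : ℝ => |b - a| * (y ^ (d : ℝ) * Real.exp (-η * y))) atTop (𝓝 0) := by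
      rw [← mul_zero |b - a|]
      exact (tendsto_rpow_mul_exp_neg_mul_atTop_nhds_zero d η hη).const_mul _
    apply squeeze_zero_norm' _ h1
    filter_upwards [eventually_ge_atTop 1] with y hy
    have h2 : ‖∫ θ in a..b, g y θ‖ ≤ Real.exp (-η * y) * |b - a| := by
      apply intervalIntegral.norm_integral_le_of_norm_le_const
      intro θ hθ
      rw [norm_integrand, Real.exp_le_exp]
      have h3 := hfar (y ^ 2) (by nlinarith) θ (hab θ hθ).1 (hab θ hθ).2
      have h4 : η * y ≤ η * y ^ 2 := mul_le_mul_of_nonneg_left (by nlinarith) hη.le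
      linarith
    rw [norm_mul, Complex.norm_real, Real.norm_of_nonneg (by positivity), Real.rpow_natCast]
    calc _ ≤ y ^ d * (Real.exp (-η * y) * |b - a|) := by gcongr
      _ = _ := by ring
  have hL := hout (-Real.pi) (-δ) (by
    intro θ hθ
    rw [Set.uIoc_of_le (by linarith)] at hθ
    rw [abs_of_neg (by linarith [hθ.2])]
    exact ⟨by linarith [hθ.2], by linarith [hθ.1]⟩)
  have hRr := hout δ Real.pi (by
    intro θ hθ
    rw [Set.uIoc_of_le (by linarith)] at hθ
    rw [abs_of_pos (by linarith [hθ.1])]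
    exact ⟨by linarith [hθ.1], by linarith [hθ.2]⟩)
  -- inner piece
  have hin : Tendsto (fun y : ℝ => ((y ^ d : ℝ) : ℂ) * ∫ θ in (-δ)..δ, g y θ) atTop
      (𝓝 ((√(Real.pi / (d / (2 * c))) : ℝ) : ℂ)) := by
    have hlim : Tendsto (fun y : ℝ => ∫ s : ℝ, (Set.Ioc (-δ * y ^ d) (δ * y ^ d)).indicator
        (fun s => g y (s / y ^ d)) s) atTop
        (𝓝 (∫ s : ℝ, ((Real.exp (-(d / (2 * c)) * s ^ 2) : ℝ) : ℂ))) := by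
      apply MeasureTheory.tendsto_integral_filter_of_dominated_convergence
        (fun s => Real.exp (-(2 * d / (c * Real.pi ^ 2)) * s ^ 2))
      · filter_upwards with y
        apply Continuous.aestronglyMeasurable _ |>.indicator measurableSet_Ioc
        exact (hgcont y).comp (by fun_prop)
      · filter_upwards [eventually_gt_atTop 0] with y hy
        filter_upwards with s
        have hyd : 0 < y ^ d := by positivity
        by_cases hs : s ∈ Set.Ioc (-δ * y ^ d) (δ * y ^ d)
        · rw [Set.indicator_of_mem hs, norm_integrand, Real.exp_le_exp]
          have hθ : |(d : ℝ) * (s / y ^ d)| ≤ Real.pi := by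
            have : |s / y ^ d| ≤ δ := by
              rw [abs_le]
              exact ⟨by rw [le_div_iff₀ hyd]; exact hs.1.le, by rw [div_le_iff₀ hyd]; exact hs.2⟩
            rw [abs_mul, abs_of_pos hdr]
            calc (d : ℝ) * |s / y ^ d| ≤ d * δ := by gcongr
              _ = Real.pi := by rw [hδ]; field_simp
          have hcos := Real.cos_le_one_sub_mul_cos_sq hθ
          have hge : (y ^ 2) ^ d / (c * d) * (1 - Real.cos (d * (s / y ^ d))) ≤
              ∑ k ∈ B, (y ^ 2) ^ k / (c * k) * (1 - Real.cos (k * (s / y ^ d))) := by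
            apply Finset.single_le_sum (f := fun k : ℕ => (y ^ 2) ^ k / (c * k) * (1 - Real.cos (k * (s / y ^ d)))) _ hd
            intro k hk
            have := Real.cos_le_one (k * (s / y ^ d))
            exact mul_nonneg (by positivity) (by linarith)
          have h5 : 2 * d / (c * Real.pi ^ 2) * s ^ 2 ≤ (y ^ 2) ^ d / (c * d) * (1 - Real.cos (d * (s / y ^ d))) := by
            calc 2 * d / (c * Real.pi ^ 2) * s ^ 2 = (y ^ 2) ^ d / (c * d) * (2 / Real.pi ^ 2 * (d * (s / y ^ d)) ^ 2) := by
                  field_simp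
                  ring
              _ ≤ _ := by
                  apply mul_le_mul_of_nonneg_left _ (by positivity)
                  linarith
          linarith
        · rw [Set.indicator_of_notMem hs, norm_zero]
          positivity
      · exact integrable_exp_neg_mul_sq (by positivity)
      · filter_upwards with s
        have h1 : Tendsto (fun y : ℝ => g y (s / y ^ d)) atTop
            (𝓝 (((Real.exp (-(d / (2 * c)) * s ^ 2) : ℝ) : ℂ))) := by
          have h2 := (Complex.continuous_exp.tendsto _).comp (PhiF_lim B hB c hc d hd hmax s)
          have h3 : Tendsto (fun y : ℝ => Complex.exp (j * ((s / y ^ d : ℝ) : ℂ) * Complex.I)) atTop (𝓝 1) := by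
            have h4 : Tendsto (fun y : ℝ => s / y ^ d) atTop (𝓝 0) :=
              tendsto_const_nhds.div_atTop (tendsto_pow_atTop (by omega))
            have h5 : Continuous (fun t : ℝ => Complex.exp (j * (t : ℂ) * Complex.I)) := by fun_prop
            have := (h5.tendsto 0).comp h4
            simpa [Function.comp_def] using this
          have := h2.mul h3
          rw [mul_one, ← Complex.ofReal_exp] at this
          exact this
        apply h1.congr'
        have h6 : Tendsto (fun y : ℝ => δ * y ^ d) atTop atTop :=
          (tendsto_pow_atTop (by omega)).const_mul_atTop hδ0
        filter_upwards [h6.eventually_gt_atTop |s|] with y hy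
        rw [Set.indicator_of_mem]
        rw [abs_lt] at hy
        exact ⟨by linarith [hy.1], hy.2.le⟩
    rw [integral_complex_ofReal, integral_gaussian] at hlim
    apply hlim.congr'
    filter_upwards [eventually_gt_atTop 0] with y hy
    have hyd : 0 < y ^ d := by positivity
    rw [MeasureTheory.integral_indicator measurableSet_Ioc, ← intervalIntegral.integral_of_le (by nlinarith),
      intervalIntegral.integral_comp_div _ hyd.ne']
    rw [mul_div_cancel_right₀ _ hyd.ne', mul_div_cancel_right₀ _ hyd.ne']
    simp
  have := (hL.add hin).add hRr
  rw [zero_add, add_zero] at this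
  refine this.congr fun y => ?_
  rw [← mul_add, ← mul_add, intervalIntegral.integral_add_adjacent_intervals (hgi y _ _) (hgi y _ _),
    intervalIntegral.integral_add_adjacent_intervals (hgi y _ _) (hgi y _ _)]

lemma exists_saddle (B : Finset ℕ) (hB : ∀ b ∈ B, 0 < b) (c : ℝ) (hc : 0 < c)
    (d : ℕ) (hd : d ∈ B) :
    ∃ y : ℕ → ℝ, (∀ n, 0 ≤ y n) ∧ (∀ n, ∑ k ∈ B, (y n ^ 2) ^ k = c * n) ∧ Tendsto y atTop atTop := by
  have hd0 := hB d hd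
  have hex : ∀ n : ℕ, ∃ y : ℝ, 0 ≤ y ∧ ∑ k ∈ B, (y ^ 2) ^ k = c * n := by
    intro n
    have hcont : Continuous (fun y : ℝ => ∑ k ∈ B, (y ^ 2) ^ k) := by fun_prop
    have h0 : ∑ k ∈ B, ((0 : ℝ) ^ 2) ^ k = 0 := by
      apply Finset.sum_eq_zero
      intro k hk
      have := (hB k hk).ne'
      simp [this]
    have hmem : c * n ∈ Set.range (fun y : ℝ => ∑ k ∈ B, (y ^ 2) ^ k) := by
      apply mem_range_of_exists_le_of_exists_ge hcont
      · exact ⟨0, by rw [h0]; positivity⟩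
      · refine ⟨1 + c * n, ?_⟩
        have h1 : ((1 + c * n) ^ 2) ^ d ≤ ∑ k ∈ B, ((1 + c * n) ^ 2) ^ k :=
          Finset.single_le_sum (f := fun k : ℕ => ((1 + c * n) ^ 2) ^ k) (fun k _ => by positivity) hd
        have hcn : 0 ≤ c * n := by positivity
        have h2 : (1 + c * n) ^ 2 ≤ ((1 + c * n) ^ 2) ^ d :=
          le_self_pow₀ (by nlinarith) hd0.ne'
        nlinarith
    obtain ⟨y, hy⟩ := hmem
    exact ⟨|y|, abs_nonneg y, by simpa using hy⟩
  choose y hy0 hy using hex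
  refine ⟨y, hy0, hy, ?_⟩
  rw [tendsto_atTop]
  intro M
  have h1 : Tendsto (fun n : ℕ => c * (n : ℝ)) atTop atTop :=
    tendsto_natCast_atTop_atTop.const_mul_atTop hc
  filter_upwards [h1.eventually_gt_atTop (∑ k ∈ B, (M ^ 2) ^ k)] with n hn
  by_contra hlt
  push Not at hlt
  rw [← hy n] at hn
  refine absurd hn (not_lt.2 ?_)
  refine Finset.sum_le_sum fun k _ => ?_
  have := hy0 n
  gcongr

lemma main_analysis (B : Finset ℕ) (hB : ∀ b ∈ B, 0 < b) (hg : B.gcd id = 1) (c : ℝ) (hc : 0 < c)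
    (d : ℕ) (hd : d ∈ B) (hmax : ∀ b ∈ B, b ≤ d)
    (u : ℕ → ℝ) (hu0 : u 0 = 1)
    (hu : ∀ n : ℕ, 0 < n → c * n * u n = ∑ k ∈ B, if k ≤ n then u (n - k) else 0) (j : ℕ) :
    Tendsto (fun n : ℕ => u (n - j) / u n / (c * n) ^ ((j : ℝ) / d)) atTop (𝓝 1) := by
  have hd0 := hB d hd
  have hdr : (0 : ℝ) < d := by exact_mod_cast hd0
  obtain ⟨y, hy0, hy, hyt⟩ := exists_saddle B hB c hc d hd
  have hLne : ((√(Real.pi / (d / (2 * c))) : ℝ) : ℂ) ≠ 0 := by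
    have := Real.pi_pos
    have : 0 < √(Real.pi / (d / (2 * c))) := Real.sqrt_pos.2 (by positivity)
    exact_mod_cast this.ne'
  have hj := (II_tendsto B hB hg c hc d hd hmax j).comp hyt
  have h0 := (II_tendsto B hB hg c hc d hd hmax 0).comp hyt
  have hratio := hj.div h0 hLne
  rw [div_self hLne] at hratio
  -- first ratio
  have h1 : Tendsto (fun n : ℕ => u (n - j) / u n / (y n ^ 2) ^ j) atTop (𝓝 1) := by
    have h2 : Tendsto (fun n : ℕ => ((u (n - j) / u n / (y n ^ 2) ^ j : ℝ) : ℂ)) atTop (𝓝 1) := by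
      apply hratio.congr'
      filter_upwards [hyt.eventually_gt_atTop 0, eventually_ge_atTop j] with n hyn hjn
      have hR : 0 < y n ^ 2 := by positivity
      have e1 := u_formula B hB c hc u hu0 hu (y n ^ 2) hR n (hy n) j hjn
      have e0 := u_formula B hB c hc u hu0 hu (y n ^ 2) hR n (hy n) 0 (Nat.zero_le _)
      rw [Nat.sub_zero] at e0
      have hF : FF B c ((y n ^ 2 : ℝ) : ℂ) ≠ 0 := Complex.exp_ne_zero _
      have hpi : (Real.pi : ℂ) ≠ 0 := by exact_mod_cast Real.pi_ne_zero
      have hyc : (y n : ℂ) ≠ 0 := by exact_mod_cast hyn.ne'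
      rw [Complex.ofReal_div, Complex.ofReal_div, e1, e0]
      simp only [Pi.div_apply, Function.comp_apply]
      generalize (∫ θ in (-Real.pi)..Real.pi, Complex.exp (PhiF B c (y n ^ 2) θ) * Complex.exp ((j : ℂ) * θ * Complex.I)) = X
      generalize (∫ θ in (-Real.pi)..Real.pi, Complex.exp (PhiF B c (y n ^ 2) θ) * Complex.exp (((0 : ℕ) : ℂ) * θ * Complex.I)) = Z
      generalize FF B c ((y n ^ 2 : ℝ) : ℂ) = F at hF
      push_cast
      by_cases hZ : Z = 0
      · simp [hZ]
      · field_simp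
    have := (Complex.continuous_re.tendsto 1).comp h2
    simpa only [Function.comp_def, Complex.ofReal_re, Complex.one_re] using this
  -- second ratio
  have h3 : Tendsto (fun n : ℕ => c * n / (y n ^ 2) ^ d) atTop (𝓝 1) := by
    have h4 : Tendsto (fun t : ℝ => (∑ k ∈ B, (t ^ 2) ^ k) / (t ^ 2) ^ d) atTop (𝓝 1) := by
      have e : (1 : ℝ) = ∑ k ∈ B, if k = d then 1 else 0 := by
        rw [Finset.sum_ite_eq' B d]; simp [hd]
      rw [e]
      simp only [Finset.sum_div]
      apply tendsto_finsetSum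
      intro k hk
      split_ifs with h
      · subst h
        apply Tendsto.congr' _ tendsto_const_nhds
        filter_upwards [eventually_gt_atTop 0] with t ht
        field_simp
      · have hlt : k < d := lt_of_le_of_ne (hmax k hk) h
        have : Tendsto (fun t : ℝ => (t ^ (2 * (d - k)))⁻¹) atTop (𝓝 0) :=
          tendsto_inv_atTop_zero.comp (tendsto_pow_atTop (by omega))
        apply this.congr'
        filter_upwards [eventually_gt_atTop 0] with t ht
        have : (t ^ 2) ^ d = (t ^ 2) ^ k * t ^ (2 * (d - k)) := by
          rw [← pow_mul, ← pow_mul, ← pow_add]; congr 1; omega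
        rw [this]
        field_simp
    refine (h4.comp hyt).congr fun n => ?_
    simp only [Function.comp_apply, hy]
  have h5 : Tendsto (fun n : ℕ => (c * n / (y n ^ 2) ^ d) ^ ((j : ℝ) / d)) atTop (𝓝 1) := by
    have := h3.rpow_const (p := (j : ℝ) / d) (Or.inl one_ne_zero)
    rwa [Real.one_rpow] at this
  have h6 := h1.div h5 one_ne_zero
  rw [div_one] at h6
  apply h6.congr'
  filter_upwards [hyt.eventually_gt_atTop 0, eventually_gt_atTop 0] with n hyn hn
  simp only [Pi.div_apply]
  have hR : 0 < y n ^ 2 := by positivity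
  have hnr : (0 : ℝ) < n := by exact_mod_cast hn
  have e2 : ((y n ^ 2) ^ d) ^ ((j : ℝ) / d) = (y n ^ 2) ^ j := by
    rw [← Real.rpow_natCast (y n ^ 2) d, ← Real.rpow_mul hR.le, mul_div_cancel₀ _ hdr.ne', Real.rpow_natCast]
  rw [Real.div_rpow (by positivity) (by positivity), e2]
  have : (c * (n : ℝ)) ^ ((j : ℝ) / d) ≠ 0 := (Real.rpow_pos_of_pos (by positivity) _).ne'
  field_simp

lemma pN_eq (A : Finset ℕ) (k : ℕ) (hk : k ∈ A) (hpos : ∀ a ∈ A, 0 < a) (N : ℕ) (hN : 0 < N)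
    (hkN : k ≤ N) : pN A k N = uu A (N - k) / uu A N / N := by
  have e1 : Nat.card ↥(permSet (A : Set ℕ) N) = cnt A (Fin N) := rfl
  have e2 : Nat.card {σ : Equiv.Perm (Fin N) // σ ∈ permSet (A : Set ℕ) N ∧
      ∃ i : Fin N, (i : ℕ) = 0 ∧ Function.minimalPeriod (⇑σ) i = k} =
      Nat.card {σ : Equiv.Perm (Fin N) // (∀ i, Function.minimalPeriod (⇑σ) i ∈ (A : Set ℕ)) ∧
        Function.minimalPeriod (⇑σ) (⟨0, hN⟩ : Fin N) = k} := by
    refine Nat.card_congr (Equiv.subtypeEquivRight fun σ => and_congr Iff.rfl ?_)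
    constructor
    · rintro ⟨i, hi, h⟩
      have : i = ⟨0, hN⟩ := Fin.ext hi
      rwa [← this]
    · intro h
      exact ⟨_, rfl, h⟩
  rw [pN, e1, e2, card_cycle_real A k hk (hpos k hk) N hN, if_pos hkN]
  have h3 := Nat.factorial_ne_zero N
  have hN' : (N : ℝ) ≠ 0 := by exact_mod_cast hN.ne'
  rw [show (cnt A (Fin N) : ℝ) = N.factorial * uu A N by rw [uu]; field_simp]
  by_cases h : uu A N = 0
  · simp [h]
  · field_simp

lemma dvd_of_uu_ne (A : Finset ℕ) (hpos : ∀ a ∈ A, 0 < a) (g : ℕ) (hg : ∀ a ∈ A, g ∣ a) (n : ℕ)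
    (h : uu A n ≠ 0) : g ∣ n := by
  induction n using Nat.strong_induction_on with
  | _ n ih =>
    rcases Nat.eq_zero_or_pos n with rfl | hn
    · exact dvd_zero g
    · have h1 := uu_rec A hpos n hn
      have hn' : (n : ℝ) ≠ 0 := by exact_mod_cast hn.ne'
      have h2 : ∑ k ∈ A, (if k ≤ n then uu A (n - k) else 0) ≠ 0 := by
        rw [← h1]; exact mul_ne_zero hn' h
      obtain ⟨k, hk, hk2⟩ := Finset.exists_ne_zero_of_sum_ne_zero h2
      split_ifs at hk2 with hkn
      · have h3 := ih (n - k) (by have := hpos k hk; omega) hk2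
        have := dvd_add h3 (hg k hk)
        rwa [Nat.sub_add_cancel hkn] at this
      · exact absurd rfl hk2

lemma pN_asymptotics_finset (A : Finset ℕ) 
    (hpos : ∀ a ∈ A, 0 < a) (d : ℕ) (hd : d ∈ A) (hmax : ∀ a ∈ A, a ≤ d)
    (k : ℕ) (hk : k ∈ A) :
    Tendsto (fun N : ℕ => pN A k N / (N : ℝ) ^ ((k : ℝ) / (d : ℝ) - 1))
      (atTop ⊓ 𝓟 {N : ℕ | (permSet A N).Nonempty}) (𝓝 1) := by
  classical
  set g := A.gcd id with hgdef
  have hgd : ∀ a ∈ A, g ∣ a := fun a ha => Finset.gcd_dvd (f := id) ha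
  have hg0 : 0 < g := Nat.pos_of_dvd_of_pos (hgd d hd) (hpos d hd)
  have hgr : (0 : ℝ) < g := by exact_mod_cast hg0
  let B : Finset ℕ := A.image (fun a => a / g)
  have hinj : ∀ a ∈ A, ∀ b ∈ A, a / g = b / g → a = b := by
    intro a ha b hb h
    rw [← Nat.div_mul_cancel (hgd a ha), h, Nat.div_mul_cancel (hgd b hb)]
  have hB : ∀ b ∈ B, 0 < b := by
    intro b hb
    obtain ⟨a, ha, rfl⟩ := Finset.mem_image.1 hb
    exact Nat.div_pos (Nat.le_of_dvd (hpos a ha) (hgd a ha)) hg0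
  have hBg : B.gcd id = 1 := by
    rw [Finset.gcd_image]
    exact Finset.gcd_div_id_eq_one hd (hpos d hd).ne'
  have hBm : ∀ b ∈ B, b ≤ d / g := by
    intro b hb
    obtain ⟨a, ha, rfl⟩ := Finset.mem_image.1 hb
    exact Nat.div_le_div_right (hmax a ha)
  have hu : ∀ n : ℕ, 0 < n → (g : ℝ) * n * uu A (g * n) =
      ∑ b ∈ B, if b ≤ n then uu A (g * (n - b)) else 0 := by
    intro n hn
    have h1 := uu_rec A hpos (g * n) (by positivity)
    rw [Nat.cast_mul] at h1
    rw [h1, Finset.sum_image (fun a ha b hb h => hinj a ha b hb h)]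
    refine Finset.sum_congr rfl fun a ha => ?_
    obtain ⟨b, rfl⟩ := hgd a ha
    rw [Nat.mul_div_cancel_left _ hg0, ← Nat.mul_sub]
    simp only [Nat.mul_le_mul_left_iff hg0]
  have hmain := main_analysis B hB hBg g hgr (d / g) (Finset.mem_image_of_mem _ hd) hBm
    (fun n => uu A (g * n)) (by simp [uu_zero]) hu (k / g)
  have hlim : Tendsto (fun N : ℕ => N / g) (atTop ⊓ 𝓟 {N : ℕ | (permSet (A : Set ℕ) N).Nonempty}) atTop :=
    (Nat.tendsto_div_const_atTop hg0.ne').mono_left inf_le_left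
  refine (hmain.comp hlim).congr' ?_
  have hev : ∀ᶠ N : ℕ in atTop ⊓ 𝓟 {N : ℕ | (permSet (A : Set ℕ) N).Nonempty}, k < N :=
    (eventually_gt_atTop k).filter_mono inf_le_left
  have hev2 : ∀ᶠ N : ℕ in atTop ⊓ 𝓟 {N : ℕ | (permSet (A : Set ℕ) N).Nonempty},
      (permSet (A : Set ℕ) N).Nonempty := (eventually_principal.2 fun N hN => hN).filter_mono inf_le_right
  filter_upwards [hev, hev2] with N hkN hne
  have hN0 : 0 < N := by omega
  have hu0 : uu A N ≠ 0 := by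
    rw [uu]
    have h1 : cnt A (Fin N) ≠ 0 := by
      have : Nonempty {σ : Equiv.Perm (Fin N) // ∀ i, Function.minimalPeriod (⇑σ) i ∈ (A : Set ℕ)} := by
        obtain ⟨σ, hσ⟩ := hne
        exact ⟨⟨σ, hσ⟩⟩
      exact Nat.card_pos.ne'
    have := Nat.factorial_ne_zero N
    positivity
  obtain ⟨n, rfl⟩ := dvd_of_uu_ne A hpos g hgd N hu0
  rw [pN_eq A k hk hpos _ hN0 hkN.le]
  obtain ⟨k', hk'⟩ := hgd k hk
  obtain ⟨d', hd'⟩ := hgd d hd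
  have hd'0 : (d' : ℝ) ≠ 0 := by
    rintro h
    have : d' = 0 := by exact_mod_cast h
    have := hpos d hd
    simp_all
  have hNr : (0 : ℝ) < ((g * n : ℕ) : ℝ) := by exact_mod_cast hN0
  simp only [Function.comp_apply]
  rw [Nat.mul_div_cancel_left _ hg0, hk', hd', Nat.mul_div_cancel_left _ hg0, Nat.mul_div_cancel_left _ hg0,
    ← Nat.mul_sub, Real.rpow_sub_one hNr.ne']
  have e : ((g * k' : ℕ) : ℝ) / ((g * d' : ℕ) : ℝ) = (k' : ℝ) / d' := by
    push_cast; field_simp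
  rw [e, ← Nat.cast_mul]
  have := (Real.rpow_pos_of_pos hNr ((k' : ℝ) / d')).ne'
  field_simp

/-- If `A` is a non-empty finite set of positive integers with maximum `d` and
`k ∈ A`, then `p_N^(A)(k) ∼ N^{(k/d)−1}` as `N → ∞` along those `N` with
`S_N^(A) ≠ ∅`. -/
theorem pN_asymptotics_finite (A : Set ℕ) (hfin : A.Finite) (hne : A.Nonempty)
    (hpos : ∀ a ∈ A, 0 < a) (d : ℕ) (hd : d ∈ A ∧ ∀ a ∈ A, a ≤ d)
    (k : ℕ) (hk : k ∈ A) :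
    Tendsto (fun N : ℕ => pN A k N / (N : ℝ) ^ ((k : ℝ) / (d : ℝ) - 1))
      (atTop ⊓ 𝓟 {N : ℕ | (permSet A N).Nonempty}) (𝓝 1) := by
  have h := pN_asymptotics_finset hfin.toFinset (by simpa using hpos) d (by simpa using hd.1)
    (by simpa using hd.2) k (by simpa using hk)
  rwa [hfin.coe_toFinset] at h
end
end

section
/- Let A be an infinite set of positive integers with Σ_{j∈ℕ∖A} 1/j < ∞ (which implies gcd(A) = 1, so S_N^(A) ≠ ∅ for all sufficiently large N), and let k ∈ A. Then p_N^(A)(k) ∼ 1/N as N → ∞; that is, N·p_N^(A)(k) → 1. -/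
noncomputable section

open Filter Topology

/-! ### Analytic part -/

/-- coefficients of `exp (∑ u_j x^(j+1)/(j+1))`. -/
def eCoef (u : ℕ → ℝ) : ℕ → ℝ
  | 0 => 1
  | n + 1 => (∑ j : Fin (n + 1), u j * eCoef u (n - j)) / (n + 1)
  decreasing_by omega

lemma eCoef_zero (u : ℕ → ℝ) : eCoef u 0 = 1 := by rw [eCoef]

lemma eCoef_succ (u : ℕ → ℝ) (n : ℕ) :
    ((n : ℝ) + 1) * eCoef u (n + 1) = ∑ j ∈ Finset.range (n + 1), u j * eCoef u (n - j) := by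
  rw [eCoef, Finset.sum_range]
  field_simp

lemma eCoef_unique (u b : ℕ → ℝ) (h0 : b 0 = 1)
    (hs : ∀ n : ℕ, ((n : ℝ) + 1) * b (n + 1) = ∑ j ∈ Finset.range (n + 1), u j * b (n - j)) (n : ℕ) :
    b n = eCoef u n := by
  induction n using Nat.strong_induction_on with
  | _ n ih =>
    cases n with
    | zero => rw [h0, eCoef_zero]
    | succ n =>
      have hn : ((n : ℝ) + 1) ≠ 0 := by positivity
      apply mul_left_cancel₀ hn
      rw [hs, eCoef_succ]
      refine Finset.sum_congr rfl fun j _ => ?_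
      rw [ih (n - j) (by omega)]

lemma eCoef_deriv (u : ℕ → ℝ) :
    PowerSeries.derivative ℝ (PowerSeries.mk (eCoef u)) = PowerSeries.mk u * PowerSeries.mk (eCoef u) := by
  ext n
  rw [PowerSeries.coeff_derivative, PowerSeries.coeff_mul, PowerSeries.coeff_mk, mul_comm,
    eCoef_succ, Finset.Nat.sum_antidiagonal_eq_sum_range_succ_mk]
  simp

lemma eCoef_mul (u v : ℕ → ℝ) (n : ℕ) :
    ∑ j ∈ Finset.range (n + 1), eCoef u j * eCoef v (n - j) = eCoef (u + v) n := by
  have key : ∀ n, PowerSeries.coeff n (PowerSeries.mk (eCoef u) * PowerSeries.mk (eCoef v))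
      = ∑ j ∈ Finset.range (n + 1), eCoef u j * eCoef v (n - j) := by
    intro n
    rw [PowerSeries.coeff_mul, Finset.Nat.sum_antidiagonal_eq_sum_range_succ_mk]
    simp
  rw [← key]
  apply eCoef_unique (u + v)
    (fun n => PowerSeries.coeff n (PowerSeries.mk (eCoef u) * PowerSeries.mk (eCoef v)))
  · simp only [key]
    simp [eCoef_zero]
  · intro n
    rw [mul_comm, ← PowerSeries.coeff_derivative]
    have : PowerSeries.derivative ℝ (PowerSeries.mk (eCoef u) * PowerSeries.mk (eCoef v))
        = PowerSeries.mk (u + v) * (PowerSeries.mk (eCoef u) * PowerSeries.mk (eCoef v)) := by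
      have h : PowerSeries.mk (u + v) = PowerSeries.mk u + PowerSeries.mk v := by
        ext n; simp
      rw [Derivation.leibniz, eCoef_deriv, eCoef_deriv, h]
      simp only [smul_eq_mul]
      ring
    rw [this, PowerSeries.coeff_mul, Finset.Nat.sum_antidiagonal_eq_sum_range_succ_mk]
    simp

lemma eCoef_one (n : ℕ) : eCoef (fun _ => 1) n = 1 := by
  symm
  apply eCoef_unique (fun _ => 1) (fun _ => 1) rfl
  intro n; simp

lemma eCoef_null (n : ℕ) : eCoef 0 n = if n = 0 then 1 else 0 := by
  symm
  apply eCoef_unique 0 (fun n => if n = 0 then 1 else 0) (by simp)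
  intro n; simp

lemma eCoef_nonneg (u : ℕ → ℝ) (hu : ∀ n, 0 ≤ u n) (n : ℕ) : 0 ≤ eCoef u n := by
  induction n using Nat.strong_induction_on with
  | _ n ih =>
    cases n with
    | zero => simp [eCoef_zero]
    | succ n =>
      rw [eCoef]
      refine div_nonneg (Finset.sum_nonneg fun j _ => mul_nonneg (hu _) (ih _ (by omega))) (by positivity)

lemma eCoef_abs_le (u : ℕ → ℝ) (hu : ∀ n, 0 ≤ u n) (n : ℕ) : |eCoef (-u) n| ≤ eCoef u n := by
  induction n using Nat.strong_induction_on with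
  | _ n ih =>
    cases n with
    | zero => simp [eCoef_zero]
    | succ n =>
      rw [eCoef, eCoef, abs_div, abs_of_nonneg (by positivity : (0:ℝ) ≤ n + 1)]
      gcongr
      refine (Finset.abs_sum_le_sum_abs _ _).trans (Finset.sum_le_sum fun j _ => ?_)
      rw [abs_mul, Pi.neg_apply, abs_neg, abs_of_nonneg (hu _)]
      exact mul_le_mul_of_nonneg_left (ih _ (by omega)) (hu _)

lemma eCoef_partial (u : ℕ → ℝ) (hu : ∀ n, 0 ≤ u n) (M : ℕ) :
    ∑ n ∈ Finset.range (M + 1), eCoef u n ≤ Real.exp (∑ j ∈ Finset.range M, u j / (j + 1)) := by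
  set d := eCoef u with hd
  have hdn : ∀ n, 0 ≤ d n := eCoef_nonneg u hu
  let P : ℝ → ℝ := fun x => ∑ n ∈ Finset.range M, d (n + 1) * x ^ (n + 1) + 1
  let P' : ℝ → ℝ := fun x => ∑ n ∈ Finset.range M, d (n + 1) * (((n + 1 : ℕ) : ℝ) * x ^ n)
  let G : ℝ → ℝ := fun x => ∑ j ∈ Finset.range M, u j / (j + 1) * x ^ (j + 1)
  let G' : ℝ → ℝ := fun x => ∑ j ∈ Finset.range M, u j / (j + 1) * (((j + 1 : ℕ) : ℝ) * x ^ j)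
  have hP : ∀ x, HasDerivAt P (P' x) x := by
    intro x
    refine (HasDerivAt.fun_sum fun n _ => ?_).add_const 1
    simpa using (hasDerivAt_pow (n + 1) x).const_mul (d (n + 1))
  have hG : ∀ x, HasDerivAt G (G' x) x := by
    intro x
    refine (HasDerivAt.fun_sum fun n _ => ?_)
    simpa using (hasDerivAt_pow (n + 1) x).const_mul (u n / (n + 1))
  have hPeq : ∀ x, P x = ∑ n ∈ Finset.range (M + 1), d n * x ^ n := by
    intro x
    rw [Finset.sum_range_succ']
    simp [P, hd, eCoef_zero]
  have hG'eq : ∀ x, G' x = ∑ j ∈ Finset.range M, u j * x ^ j := by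
    intro x
    refine Finset.sum_congr rfl fun j _ => ?_
    push_cast
    field_simp
  have hle : ∀ x, 0 ≤ x → P' x ≤ G' x * P x := by
    intro x hx
    rw [hG'eq, hPeq, Finset.sum_mul_sum, ← Finset.sum_product']
    have h1 : P' x = ∑ q ∈ (Finset.range M).sigma (fun n => Finset.range (n + 1)),
        (u q.2 * x ^ q.2) * (d (q.1 - q.2) * x ^ (q.1 - q.2)) := by
      rw [Finset.sum_sigma]
      refine Finset.sum_congr rfl fun n _ => ?_
      have := eCoef_succ u n
      push_cast
      calc d (n + 1) * (((n : ℝ) + 1) * x ^ n) = (((n : ℝ) + 1) * d (n + 1)) * x ^ n := by ring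
        _ = _ := by
          rw [this, Finset.sum_mul]
          refine Finset.sum_congr rfl fun j hj => ?_
          have hj' : j ≤ n := by simpa [Nat.lt_succ_iff] using hj
          conv_lhs => rw [← Nat.add_sub_cancel' hj', pow_add]
          rw [Nat.add_sub_cancel' hj']
          ring
    rw [h1]
    rw [← Finset.sum_image (s := (Finset.range M).sigma (fun n => Finset.range (n + 1)))
      (g := fun q : (Σ _ : ℕ, ℕ) => (q.2, q.1 - q.2))
      (f := fun q : ℕ × ℕ => (u q.1 * x ^ q.1) * (d q.2 * x ^ q.2))]
    · apply Finset.sum_le_sum_of_subset_of_nonneg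
      · intro q hq
        simp only [Finset.mem_image, Finset.mem_sigma, Finset.mem_range] at hq
        obtain ⟨⟨a, b⟩, h, rfl⟩ := hq
        simp only [Finset.mem_product, Finset.mem_range]
        simp only at h
        omega
      · intro q _ _
        have := hu q.1
        have := hdn q.2
        positivity
    · rintro ⟨a, b⟩ h ⟨a', b'⟩ h' heq
      simp only [Finset.coe_sigma, Set.mem_sigma_iff, Finset.mem_coe, Finset.mem_range] at h h'
      simp only [Prod.mk.injEq] at heq
      obtain ⟨rfl, h2⟩ := heq
      have : a = a' := by omega
      subst this
      rfl
  have hh : ∀ x, HasDerivAt (fun x => P x * Real.exp (-G x))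
      (P' x * Real.exp (-G x) + P x * (Real.exp (-G x) * -G' x)) x := fun x =>
    (hP x).mul ((hG x).neg.exp)
  have hanti : AntitoneOn (fun x => P x * Real.exp (-G x)) (Set.Icc 0 1) := by
    apply antitoneOn_of_deriv_nonpos (convex_Icc 0 1)
    · exact fun x _ => (hh x).continuousAt.continuousWithinAt
    · exact fun x _ => (hh x).differentiableAt.differentiableWithinAt
    · intro x hx
      rw [interior_Icc] at hx
      rw [(hh x).deriv]
      have := hle x hx.1.le
      have := Real.exp_pos (-G x)
      nlinarith
  have h01 := hanti (Set.left_mem_Icc.2 zero_le_one) (Set.right_mem_Icc.2 zero_le_one) zero_le_one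
  have hP0 : P 0 = 1 := by simp [P]
  have hG0 : G 0 = 0 := by simp [G]
  have hP1 : P 1 = ∑ n ∈ Finset.range (M + 1), d n := by simp [hPeq]
  have hG1 : G 1 = ∑ j ∈ Finset.range M, u j / (j + 1) := by simp [G]
  simp only [hP0, hG0, hP1, hG1, neg_zero, Real.exp_zero, mul_one, Real.exp_neg] at h01
  rwa [← div_eq_mul_inv, div_le_one (Real.exp_pos _)] at h01

lemma eCoef_summable (u : ℕ → ℝ) (hu : ∀ n, 0 ≤ u n) (hs : Summable fun j : ℕ => u j / (j + 1)) :
    Summable (eCoef u) := by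
  apply summable_of_sum_range_le (c := Real.exp (∑' j : ℕ, u j / (j + 1))) (eCoef_nonneg u hu)
  intro n
  calc ∑ i ∈ Finset.range n, eCoef u i ≤ ∑ i ∈ Finset.range (n + 1), eCoef u i := by
        rw [Finset.sum_range_succ]
        linarith [eCoef_nonneg u hu n]
    _ ≤ _ := eCoef_partial u hu n
    _ ≤ _ := by
        apply Real.exp_le_exp.2
        exact hs.sum_le_tsum _ fun i _ => div_nonneg (hu i) (by positivity)

lemma eCoef_tendsto (u : ℕ → ℝ) (hu : ∀ n, 0 ≤ u n) (hs : Summable fun j : ℕ => u j / (j + 1)) :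
    ∃ c : ℝ, c ≠ 0 ∧ Tendsto (eCoef (fun j => 1 - u j)) atTop (𝓝 c) := by
  have hd := eCoef_summable u hu hs
  have hdn : Summable fun n => ‖eCoef u n‖ := by
    simpa [abs_of_nonneg (eCoef_nonneg u hu _)] using hd
  have hcn : Summable fun n => ‖eCoef (-u) n‖ :=
    Summable.of_nonneg_of_le (fun _ => norm_nonneg _) (eCoef_abs_le u hu) hd
  have hc : Summable (eCoef (-u)) := hcn.of_norm
  refine ⟨∑' n, eCoef (-u) n, ?_, ?_⟩
  · have := tsum_mul_tsum_eq_tsum_sum_range_of_summable_norm hcn hdn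
    simp only [eCoef_mul, neg_add_cancel, eCoef_null, tsum_ite_eq] at this
    intro h
    simp [h] at this
  · have h := (tendsto_add_atTop_iff_nat 1).2 hc.hasSum.tendsto_sum_nat
    refine h.congr fun n => ?_
    have := eCoef_mul (-u) (fun _ => 1) n
    simp only [eCoef_one, mul_one] at this
    rw [this]
    congr 1
    ext j
    simp; ring

/-! ### Combinatorial part -/

section comb
open Equiv Function

lemma minPer_pos {α : Type*} [Finite α] (σ : Perm α) (x : α) : 0 < minimalPeriod σ x :=
  minimalPeriod_pos_of_mem_periodicPts (σ.injective.mem_periodicPts x)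

lemma sameCycle_iff_iter {α : Type*} [Finite α] (σ : Perm α) (x y : α) :
    σ.SameCycle x y ↔ ∃ i < minimalPeriod σ x, σ^[i] x = y := by
  constructor
  · intro h
    obtain ⟨i, -, hi⟩ := h.exists_pow_eq'
    refine ⟨i % minimalPeriod σ x, Nat.mod_lt _ (minPer_pos σ x), ?_⟩
    rw [iterate_mod_minimalPeriod_eq, ← hi, Perm.iterate_eq_pow]
  · rintro ⟨i, -, hi⟩
    exact ⟨i, by rw [← hi, Perm.iterate_eq_pow]; simp⟩

/-- period of `x` is `k` and all elements outside the cycle of `x` have period in `A`. -/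
def RP (A : Set ℕ) {α : Type*} (σ : Perm α) (x : α) (k : ℕ) : Prop :=
  minimalPeriod σ x = k ∧ ∀ y, ¬ σ.SameCycle x y → minimalPeriod σ y ∈ A

lemma minPer_semiconj {α β : Type*} (f : α → α) (g : β → β) (e : α → β) (he : Injective e)
    (x : α) (h : ∀ i, g^[i] (e x) = e (f^[i] x)) : minimalPeriod g (e x) = minimalPeriod f x := by
  apply minimalPeriod_eq_minimalPeriod_iff.2
  intro n
  simp only [IsPeriodicPt, IsFixedPt, h, he.eq_iff]

lemma minPer_sameCycle {α : Type*} [Finite α] (σ : Perm α) (x y : α) (h : σ.SameCycle x y) :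
    minimalPeriod σ x = minimalPeriod σ y := by
  obtain ⟨i, -, rfl⟩ := (sameCycle_iff_iter σ x y).1 h
  exact (minimalPeriod_apply_iterate (σ.injective.mem_periodicPts x) i).symm

lemma all_iff_RP (A : Set ℕ) {α : Type*} [Finite α] (σ : Perm α) (x : α) (k : ℕ) (hk : k ∈ A) :
    ((∀ i, minimalPeriod σ i ∈ A) ∧ minimalPeriod σ x = k) ↔ RP A σ x k := by
  constructor
  · rintro ⟨h1, h2⟩
    exact ⟨h2, fun y _ => h1 y⟩
  · rintro ⟨h1, h2⟩
    refine ⟨fun y => ?_, h1⟩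
    by_cases h : σ.SameCycle x y
    · rw [← minPer_sameCycle σ x y h, h1]; exact hk
    · exact h2 y h

lemma RP_none (A : Set ℕ) {α : Type*} [DecidableEq α] [Finite α] (τ : Perm α) :
    RP A (Perm.decomposeOption.symm (none, τ)) none 1 ↔ ∀ y, minimalPeriod τ y ∈ A := by
  set σ := Perm.decomposeOption.symm (none, τ) with hσ
  have h0 : σ none = none := by simp [hσ]
  have h1 : ∀ y, σ (some y) = some (τ y) := by intro y; simp [hσ]
  have h2 : ∀ i y, σ^[i] (some y) = some (τ^[i] y) := by
    intro i
    induction i with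
    | zero => simp
    | succ i ih => intro y; simp [h1, ih]
  have hp : ∀ y, minimalPeriod σ (some y) = minimalPeriod τ y := fun y =>
    minPer_semiconj τ σ some (Option.some_injective _) y (fun i => h2 i y)
  have hm : minimalPeriod σ none = 1 := minimalPeriod_eq_one_iff_isFixedPt.2 h0
  constructor
  · rintro ⟨-, h⟩ y
    rw [← hp]
    apply h
    rw [sameCycle_iff_iter, hm]
    rintro ⟨i, hi, h⟩
    have : i = 0 := by omega
    subst this
    simp at h
  · intro h
    refine ⟨hm, fun y hy => ?_⟩
    cases y with
    | none => exact absurd (Perm.SameCycle.refl _ _) hy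
    | some y => rw [hp]; exact h y

lemma RP_none_succ (A : Set ℕ) {α : Type*} [DecidableEq α] [Finite α] (τ : Perm α) (k : ℕ)
    (h : RP A (Perm.decomposeOption.symm (none, τ)) none k) : k = 1 := by
  rw [← h.1]
  exact minimalPeriod_eq_one_iff_isFixedPt.2 (by simp [IsFixedPt])

lemma RP_some_aux {α : Type*} [DecidableEq α] [Finite α] (τ : Perm α) (x : α)
    (σ : Perm (Option α)) (hσ : σ = Perm.decomposeOption.symm (some x, τ)) :
    minimalPeriod σ none = minimalPeriod τ x + 1 ∧
    (∀ y, σ.SameCycle none (some y) ↔ τ.SameCycle x y) ∧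
    (∀ y, ¬ τ.SameCycle x y → minimalPeriod σ (some y) = minimalPeriod τ y) := by
  have h0 : σ none = some x := by simp [hσ]
  have h1 : ∀ y, τ y = x → σ (some y) = none := by
    intro y hy; simp [hσ, hy]
  have h2 : ∀ y, τ y ≠ x → σ (some y) = some (τ y) := by
    intro y hy
    simp only [hσ, Perm.decomposeOption_symm_apply, Perm.coe_mul, Function.comp_apply, optionCongr_apply,
      Option.map_some]
    exact swap_apply_of_ne_of_ne (by simp) (by simpa using hy)
  have hit : ∀ i < minimalPeriod τ x, σ^[i + 1] none = some (τ^[i] x) := by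
    intro i
    induction i with
    | zero => simp [h0]
    | succ i ih =>
      intro hi
      rw [iterate_succ_apply', ih (by omega), h2, ← iterate_succ_apply' τ]
      rw [← iterate_succ_apply' τ]
      exact not_isPeriodicPt_of_pos_of_lt_minimalPeriod (by omega) hi
  have hpos := minPer_pos τ x
  have hper : σ^[minimalPeriod τ x + 1] none = none := by
    obtain ⟨m, hm⟩ : ∃ m, minimalPeriod τ x = m + 1 := ⟨minimalPeriod τ x - 1, by omega⟩
    rw [hm, iterate_succ_apply', hit m (by omega), h1]
    rw [← iterate_succ_apply' τ, Nat.succ_eq_add_one, ← hm]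
    exact isPeriodicPt_minimalPeriod _ _
  have hmin : minimalPeriod σ none = minimalPeriod τ x + 1 := by
    have hle : minimalPeriod σ none ≤ minimalPeriod τ x + 1 :=
      IsPeriodicPt.minimalPeriod_le (by omega) hper
    by_contra hne
    have hp := minPer_pos σ none
    obtain ⟨m, hm⟩ : ∃ m, minimalPeriod σ none = m + 1 := ⟨minimalPeriod σ none - 1, by omega⟩
    have h3 : σ^[minimalPeriod σ none] none = none := isPeriodicPt_minimalPeriod _ _
    rw [hm, hit m (by omega)] at h3
    simp at h3
  have hout : ∀ y, ¬ τ.SameCycle x y → ∀ i, σ^[i] (some y) = some (τ^[i] y) := by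
    intro y hy i
    induction i with
    | zero => simp
    | succ i ih =>
      rw [iterate_succ_apply', ih, h2, iterate_succ_apply' τ]
      rw [← iterate_succ_apply' τ]
      intro h
      apply hy
      apply Perm.SameCycle.symm
      exact ⟨(i + 1 : ℕ), by rw [← h, Perm.iterate_eq_pow]; simp only [zpow_natCast]⟩
  refine ⟨hmin, fun y => ⟨fun h => ?_, fun h => ?_⟩, fun y hy =>
    minPer_semiconj τ σ some (Option.some_injective _) y (hout y hy)⟩
  · by_contra hy
    obtain ⟨i, -, hi⟩ := (sameCycle_iff_iter _ _ _).1 h.symm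
    rw [hout y hy] at hi
    simp at hi
  · obtain ⟨i, hi, rfl⟩ := (sameCycle_iff_iter _ _ _).1 h
    rw [sameCycle_iff_iter]
    exact ⟨i + 1, by omega, hit i hi⟩

lemma RP_some (A : Set ℕ) {α : Type*} [DecidableEq α] [Finite α] (τ : Perm α) (x : α) (k : ℕ) :
    RP A (Perm.decomposeOption.symm (some x, τ)) none (k + 1) ↔ RP A τ x k := by
  obtain ⟨h1, h2, h3⟩ := RP_some_aux τ x _ rfl
  constructor
  · rintro ⟨ha, hb⟩
    refine ⟨by omega, fun y hy => ?_⟩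
    rw [← h3 y hy]
    exact hb _ (by rwa [h2])
  · rintro ⟨ha, hb⟩
    refine ⟨by omega, fun y hy => ?_⟩
    cases y with
    | none => exact absurd (Perm.SameCycle.refl _ _) hy
    | some y =>
      rw [h2] at hy
      rw [h3 y hy]
      exact hb y hy

/-- number of permutations with `RP`. -/
def QN (A : Set ℕ) (α : Type*) (x : α) (k : ℕ) : ℕ := Nat.card {σ : Perm α // RP A σ x k}

lemma QN_congr (A : Set ℕ) {α β : Type*} (e : α ≃ β) (x : α) (k : ℕ) :
    QN A α x k = QN A β (e x) k := by
  apply Nat.card_congr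
  refine e.permCongr.subtypeEquiv fun σ => ?_
  have hit : ∀ y i, (e.permCongr σ)^[i] (e y) = e (σ^[i] y) := by
    intro y i
    induction i with
    | zero => simp
    | succ i ih => rw [iterate_succ_apply', ih, iterate_succ_apply']; simp
  have hp : ∀ y, minimalPeriod (e.permCongr σ) (e y) = minimalPeriod σ y := fun y =>
    minPer_semiconj _ _ e e.injective y (hit y)
  have hs : ∀ y, (e.permCongr σ).SameCycle (e x) (e y) ↔ σ.SameCycle x y := by
    intro y
    have hz : ∀ n : ℤ, (e.permCongr σ) ^ n = e.permCongr (σ ^ n) := fun n =>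
      (map_zpow e.permCongrHom σ n).symm
    simp [Perm.SameCycle, hz]
  unfold RP
  rw [hp, e.surjective.forall]
  simp only [hp, hs]

lemma QN_one (A : Set ℕ) (n : ℕ) :
    QN A (Option (Fin n)) none 1 = Nat.card (permSet A n) := by
  symm
  refine Nat.card_congr (Equiv.ofBijective
    (fun τ => ⟨Perm.decomposeOption.symm (none, τ.1), (RP_none A τ.1).2 τ.2⟩) ⟨?_, ?_⟩)
  · intro τ τ' h
    simpa [Subtype.ext_iff, -Perm.decomposeOption_symm_apply] using h
  · rintro ⟨σ, hσ⟩
    obtain ⟨⟨o, τ⟩, rfl⟩ := Perm.decomposeOption.symm.surjective σ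
    cases o with
    | none => exact ⟨⟨τ, (RP_none A τ).1 hσ⟩, rfl⟩
    | some x =>
      have := (RP_some A τ x 0).1 hσ
      exact absurd this.1 (minPer_pos τ x).ne'

lemma QN_succ (A : Set ℕ) (α : Type) [Fintype α] [DecidableEq α] (k : ℕ) :
    QN A (Option α) none (k + 2) = ∑ x : α, QN A α x (k + 1) := by
  unfold QN
  rw [← Nat.card_sigma]
  symm
  refine Nat.card_congr (Equiv.ofBijective
    (fun τ => ⟨Perm.decomposeOption.symm (some τ.1, τ.2.1), (RP_some A τ.2.1 τ.1 (k + 1)).2 τ.2.2⟩) ⟨?_, ?_⟩)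
  · rintro ⟨x, τ, h⟩ ⟨x', τ', h'⟩ he
    have := Perm.decomposeOption.symm.injective (Subtype.ext_iff.1 he)
    simp only [Prod.mk.injEq, Option.some.injEq] at this
    obtain ⟨rfl, rfl⟩ := this
    rfl
  · rintro ⟨σ, hσ⟩
    obtain ⟨⟨o, τ⟩, rfl⟩ := Perm.decomposeOption.symm.surjective σ
    cases o with
    | none => exact absurd (RP_none_succ A τ _ hσ) (by omega)
    | some x => exact ⟨⟨x, τ, (RP_some A τ x (k + 1)).1 hσ⟩, rfl⟩

lemma QN_fin (A : Set ℕ) (n : ℕ) (x : Fin (n + 1)) (k : ℕ) :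
    QN A (Fin (n + 1)) x k = QN A (Option (Fin n)) none k := by
  have := QN_congr A (finSuccEquiv' x) x k
  simpa using this

lemma QN_formula (A : Set ℕ) (k n : ℕ) (hkn : k ≤ n) :
    QN A (Option (Fin n)) none (k + 1) * (n - k).factorial
      = n.factorial * Nat.card (permSet A (n - k)) := by
  induction k generalizing n with
  | zero => rw [QN_one, mul_comm]; rfl
  | succ k ih =>
    obtain ⟨m, rfl⟩ : ∃ m, n = m + 1 := ⟨n - 1, by omega⟩
    rw [QN_succ]
    simp only [QN_fin]
    have := ih m (by omega)
    simp only [Finset.sum_const, Finset.card_univ, Fintype.card_fin, smul_eq_mul,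
      Nat.add_sub_add_right, Nat.factorial_succ]
    rw [mul_assoc, this, mul_assoc, Nat.add_sub_add_right]

lemma card_permSet_succ (A : Set ℕ) (n : ℕ) [DecidablePred (· ∈ A)] :
    Nat.card (permSet A (n + 1))
      = ∑ k ∈ Finset.range (n + 1), if k + 1 ∈ A then QN A (Option (Fin n)) none (k + 1) else 0 := by
  have hb : ∀ σ : Perm (Fin (n + 1)), minimalPeriod σ 0 - 1 < n + 1 := by
    intro σ
    have : minimalPeriod σ 0 ≤ n + 1 := by
      simpa using minimalPeriod_le_card (f := σ) (x := (0 : Fin (n + 1)))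
    omega
  have e : permSet A (n + 1) ≃ Σ k : Fin (n + 1),
      {σ : Perm (Fin (n + 1)) // (∀ i, minimalPeriod σ i ∈ A) ∧ minimalPeriod σ 0 = k + 1} :=
    { toFun := fun σ => ⟨⟨_, hb σ.1⟩, σ.1, σ.2, by
        have := minPer_pos σ.1 0
        simp only
        omega⟩
      invFun := fun s => ⟨s.2.1, s.2.2.1⟩
      left_inv := fun σ => rfl
      right_inv := by
        rintro ⟨⟨k, hk⟩, σ, h1, h2⟩
        simp only at h2
        have : minimalPeriod σ 0 - 1 = k := by omega
        subst this
        rfl }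
  rw [Nat.card_congr e, Nat.card_sigma, Finset.sum_range]
  refine Finset.sum_congr rfl fun k _ => ?_
  split_ifs with h
  · rw [← QN_fin A n 0]
    apply Nat.card_congr
    exact Equiv.subtypeEquivRight fun σ => all_iff_RP A σ 0 _ h
  · have : IsEmpty {σ : Perm (Fin (n + 1)) // (∀ i, minimalPeriod σ i ∈ A) ∧ minimalPeriod σ 0 = k + 1} :=
      ⟨fun σ => h (by rw [← σ.2.2]; exact σ.2.1 0)⟩
    exact Nat.card_of_isEmpty

lemma pN_eq_s13 (A : Set ℕ) (k n : ℕ) (hk : k ∈ A) :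
    pN A k (n + 1) = QN A (Option (Fin n)) none k / Nat.card (permSet A (n + 1)) := by
  unfold pN
  rw [← QN_fin A n 0]
  congr 2
  apply Nat.card_congr
  refine Equiv.subtypeEquivRight fun σ => ?_
  rw [← all_iff_RP A σ 0 _ hk]
  refine and_congr Iff.rfl ⟨?_, fun h => ⟨0, rfl, h⟩⟩
  rintro ⟨i, hi, h⟩
  have : i = 0 := Fin.ext hi
  rwa [← this]

end comb

/-- normalized counts -/
def bN (A : Set ℕ) (n : ℕ) : ℝ := Nat.card (permSet A n) / n.factorial

lemma QN_real (A : Set ℕ) (k n : ℕ) (hkn : k ≤ n) :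
    (QN A (Option (Fin n)) none (k + 1) : ℝ) = n.factorial * bN A (n - k) := by
  have h := QN_formula A k n hkn
  have hf : ((n - k).factorial : ℝ) ≠ 0 := by positivity
  unfold bN
  rw [mul_div_assoc', eq_div_iff hf]
  exact_mod_cast h

lemma bN_zero (A : Set ℕ) : bN A 0 = 1 := by
  have : permSet A 0 = Set.univ := by
    ext σ
    simp [permSet]
  simp [bN, this]

lemma bN_eq (A : Set ℕ) (n : ℕ) :
    bN A n = eCoef (fun j => 1 - (Aᶜ : Set ℕ).indicator 1 (j + 1)) n := by
  classical
  apply eCoef_unique _ _ (bN_zero A)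
  intro n
  have h1 : ((n : ℝ) + 1) * bN A (n + 1) = (Nat.card (permSet A (n + 1)) : ℝ) / n.factorial := by
    unfold bN
    rw [Nat.factorial_succ]
    push_cast
    field_simp
  rw [h1, card_permSet_succ, Nat.cast_sum, Finset.sum_div]
  refine Finset.sum_congr rfl fun j hj => ?_
  have hj' : j ≤ n := by simpa [Nat.lt_succ_iff] using hj
  by_cases h : j + 1 ∈ A
  · simp only [h, if_true, QN_real A j n hj']
    simp [h]
    field_simp
  · simp [h]

/-- If `A` is an infinite set of positive integers with `Σ_{j ∉ A} 1/j < ∞` and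
`k ∈ A`, then `p_N^(A)(k) ∼ 1/N` as `N → ∞`; that is, `N · p_N^(A)(k) → 1`. -/
theorem pN_asymptotics_infinite (A : Set ℕ) (hinf : A.Infinite)
    (hpos : ∀ a ∈ A, 0 < a)
    (hsum : Summable ((Aᶜ : Set ℕ).indicator fun j => (1 : ℝ) / j))
    (k : ℕ) (hk : k ∈ A) :
    Tendsto (fun N : ℕ => (N : ℝ) * pN A k N) atTop (𝓝 1) := by
  obtain ⟨c, hc, hlim⟩ := eCoef_tendsto (fun j => (Aᶜ : Set ℕ).indicator 1 (j + 1))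
    (fun n => Set.indicator_nonneg (fun _ _ => zero_le_one) _) (by
      refine ((summable_nat_add_iff 1).2 hsum).congr fun j => ?_
      by_cases h : j + 1 ∈ A
      · simp [h]
      · simp [h])
  have hb : Tendsto (bN A) atTop (𝓝 c) := hlim.congr fun n => (bN_eq A n).symm
  have hb2 : Tendsto (fun n => bN A (n - k)) atTop (𝓝 c) := hb.comp (tendsto_sub_atTop_nat k)
  have hr := hb2.div hb hc
  rw [div_self hc] at hr
  refine hr.congr' ?_
  filter_upwards [eventually_ge_atTop (k + 1)] with N hN
  obtain ⟨n, rfl⟩ : ∃ n, N = n + 1 := ⟨N - 1, by omega⟩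
  obtain ⟨m, rfl⟩ : ∃ m, k = m + 1 := ⟨k - 1, by have := hpos k hk; omega⟩
  rw [pN_eq_s13 A _ n hk, QN_real A m n (by omega)]
  simp only [Pi.div_apply, Nat.add_sub_add_right]
  conv_lhs => rw [bN.eq_def A (n + 1), Nat.factorial_succ]
  push_cast
  rw [div_div_eq_mul_div]
  ring
end
end

section
/- Let A be an infinite set of positive integers with Σ_{j∈ℕ∖A} 1/j < ∞. Then lim_{N→∞} a_N^(A)/N! = exp(−Σ_{j∈ℕ∖A} 1/j). -/
noncomputable section

open Filter Topology

/-- Permutations of an arbitrary type all of whose cycle lengths lie in `A`. -/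
def goodPerm (A : Set ℕ) (α : Type) : Set (Equiv.Perm α) :=
  {σ | ∀ i : α, Function.minimalPeriod (⇑σ) i ∈ A}

theorem minimalPeriod_of_semiconj {α β : Type} {f : α → α} {h : β → β} {g : α → β}
    (hg : Function.Injective g) (hc : ∀ x, h (g x) = g (f x)) (x : α) :
    Function.minimalPeriod h (g x) = Function.minimalPeriod f x := by
  rw [Function.minimalPeriod_eq_minimalPeriod_iff]
  intro n
  have hs : Function.Semiconj g f h := fun x => (hc x).symm
  unfold Function.IsPeriodicPt Function.IsFixedPt
  rw [← (hs.iterate_right n).eq x]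
  exact hg.eq_iff

theorem card_goodPerm_congr (A : Set ℕ) {α β : Type} (e : α ≃ β) :
    Nat.card (goodPerm A α) = Nat.card (goodPerm A β) := by
  refine Nat.card_congr (Equiv.subtypeEquiv e.permCongr fun σ => ?_)
  have key : ∀ i, Function.minimalPeriod (e.permCongr σ) (e i) = Function.minimalPeriod σ i :=
    fun i => minimalPeriod_of_semiconj e.injective (fun x => by simp) i
  constructor
  · intro h j
    have := h (e.symm j)
    rwa [← key, e.apply_symm_apply] at this
  · intro h i
    rw [← key]; exact h _

theorem iterate_add_one_fin (k n : ℕ) (i : Fin (k + 1)) :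
    (((fun x : Fin (k + 1) => x + 1)^[n] i : Fin (k + 1)) : ℕ) = (i + n) % (k + 1) := by
  induction n with
  | zero => simp [Nat.mod_eq_of_lt i.2]
  | succ n ih =>
    rw [Function.iterate_succ_apply', Fin.val_add, ih]
    rcases k with _ | k
    · simp [Nat.mod_one]
    · simp [add_assoc]

theorem minimalPeriod_add_one_fin (k : ℕ) (i : Fin (k + 1)) :
    Function.minimalPeriod (fun x : Fin (k + 1) => x + 1) i = k + 1 := by
  have h : ∀ n, Function.IsPeriodicPt (fun x : Fin (k + 1) => x + 1) n i ↔ k + 1 ∣ n := by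
    intro n
    unfold Function.IsPeriodicPt Function.IsFixedPt
    rw [Fin.ext_iff, iterate_add_one_fin]
    have h2 : (i + n) % (k + 1) = (i : ℕ) ↔ (i : ℕ) + n ≡ i + 0 [MOD (k + 1)] := by
      unfold Nat.ModEq
      rw [add_zero, Nat.mod_eq_of_lt i.2]
    rw [h2, ← Nat.modEq_zero_iff_dvd]
    exact ⟨fun h => Nat.ModEq.add_left_cancel' _ h, fun h => Nat.ModEq.add_left _ h⟩
  apply Nat.dvd_antisymm
  · exact Function.IsPeriodicPt.minimalPeriod_dvd ((h _).2 dvd_rfl)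
  · exact (h _).1 (Function.isPeriodicPt_minimalPeriod _ _)

/-- Fibre over the embedding `Sum.inl`. -/
theorem card_fiber_sum (A : Set ℕ) (k : ℕ) (hk : k + 1 ∈ A) (β : Type) [Finite β] :
    Nat.card {σ : Equiv.Perm (Fin (k + 1) ⊕ β) // σ ∈ goodPerm A (Fin (k + 1) ⊕ β) ∧
      ∀ i, σ (Sum.inl i) = Sum.inl (i + 1)} = Nat.card (goodPerm A β) := by
  symm
  have hinr : ∀ (τ : Equiv.Perm β) (b : β),
      Function.minimalPeriod (Equiv.sumCongr (Equiv.addRight (1 : Fin (k + 1))) τ) (Sum.inr b) =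
        Function.minimalPeriod τ b := fun τ b =>
    minimalPeriod_of_semiconj (g := Sum.inr) Sum.inr_injective (fun x => by simp) b
  have hinl : ∀ (τ : Equiv.Perm β) (i : Fin (k + 1)),
      Function.minimalPeriod (Equiv.sumCongr (Equiv.addRight (1 : Fin (k + 1))) τ) (Sum.inl i) =
        k + 1 := fun τ i => by
    refine Eq.trans ?_ (minimalPeriod_add_one_fin k i)
    exact minimalPeriod_of_semiconj (g := Sum.inl) Sum.inl_injective (fun x => by simp) i
  refine Nat.card_congr (Equiv.ofBijective
    (fun τ : goodPerm A β => ⟨Equiv.sumCongr (Equiv.addRight (1 : Fin (k + 1))) τ.1, ?_, ?_⟩)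
    ⟨?_, ?_⟩)
  · rintro (i | b)
    · rw [hinl]; exact hk
    · rw [hinr]; exact τ.2 b
  · intro i; simp
  · rintro ⟨τ, _⟩ ⟨τ', _⟩ h
    have h2 := congrArg Subtype.val h
    simp only at h2
    apply Subtype.ext
    ext b
    have := Equiv.congr_fun h2 (Sum.inr b)
    simpa using this
  · rintro ⟨σ, hσ, hrot⟩
    have hm : σ ∈ (Equiv.Perm.sumCongrHom (Fin (k + 1)) β).range := by
      apply Equiv.Perm.mem_sumCongrHom_range_of_perm_mapsTo_inl
      rintro _ ⟨i, rfl⟩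
      exact ⟨i + 1, (hrot i).symm⟩
    obtain ⟨⟨ρ, τ⟩, rfl⟩ := hm
    have hρ : ρ = Equiv.addRight (1 : Fin (k + 1)) := by
      ext i
      have := hrot i
      simp at this
      simp [this]
    subst hρ
    refine ⟨⟨τ, fun b => ?_⟩, rfl⟩
    rw [← hinr]
    exact hσ _

theorem card_fiber (A : Set ℕ) (k : ℕ) (hk : k + 1 ∈ A) (N : ℕ) (e : Fin (k + 1) ↪ Fin N) :
    Nat.card {σ : Equiv.Perm (Fin N) // σ ∈ goodPerm A (Fin N) ∧
      ∀ i, σ (e i) = e (i + 1)} = Nat.card (goodPerm A (Fin (N - (k + 1)))) := by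
  classical
  let E : Fin (k + 1) ⊕ ((Set.range e)ᶜ : Set (Fin N)) ≃ Fin N :=
    (Equiv.sumCongr (Equiv.ofInjective e e.injective) (Equiv.refl _)).trans
      (Equiv.Set.sumCompl (Set.range e))
  have hE : ∀ i, E (Sum.inl i) = e i := fun i => by simp [E]
  have hcard : Nat.card ((Set.range e)ᶜ : Set (Fin N)) = N - (k + 1) := by
    have h1 := Nat.card_congr E
    rw [Nat.card_sum] at h1
    simp only [Nat.card_eq_fintype_card, Fintype.card_fin] at h1 ⊢
    omega
  rw [← card_goodPerm_congr A (Finite.equivFinOfCardEq hcard), ← card_fiber_sum A k hk]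
  symm
  refine Nat.card_congr (Equiv.subtypeEquiv E.permCongr fun σ => ?_)
  have key : ∀ i, Function.minimalPeriod (E.permCongr σ) (E i) = Function.minimalPeriod σ i :=
    fun i => minimalPeriod_of_semiconj E.injective (fun x => by simp) i
  refine and_congr ⟨fun h j => ?_, fun h i => ?_⟩ (forall_congr' fun i => ?_)
  · have := h (E.symm j)
    rwa [← key, E.apply_symm_apply] at this
  · rw [← key]; exact h _
  · rw [← hE, ← hE, Equiv.permCongr_apply, E.symm_apply_apply, E.injective.eq_iff]

/-- Pairs (good permutation, point on a cycle of length `k+1`). -/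
theorem card_pairs (A : Set ℕ) (k : ℕ) (hk : k + 1 ∈ A) (N : ℕ) :
    Nat.card {p : Equiv.Perm (Fin N) × Fin N // p.1 ∈ goodPerm A (Fin N) ∧
      Function.minimalPeriod p.1 p.2 = k + 1} =
    N.descFactorial (k + 1) * Nat.card (goodPerm A (Fin (N - (k + 1)))) := by
  classical
  have h1 : Nat.card (Σ e : Fin (k + 1) ↪ Fin N, {σ : Equiv.Perm (Fin N) //
      σ ∈ goodPerm A (Fin N) ∧ ∀ i, σ (e i) = e (i + 1)}) =
      N.descFactorial (k + 1) * Nat.card (goodPerm A (Fin (N - (k + 1)))) := by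
    rw [Nat.card_sigma]
    simp only [card_fiber A k hk N]
    simp [Fintype.card_embedding_eq]
  rw [← h1]
  symm
  have hsemi : ∀ (e : Fin (k + 1) ↪ Fin N) (σ : Equiv.Perm (Fin N)),
      (∀ i, σ (e i) = e (i + 1)) → ∀ n : ℕ, (⇑σ)^[n] (e 0) = e (Fin.ofNat (k + 1) n) := by
    intro e σ h n
    induction n with
    | zero => rfl
    | succ n ih =>
      rw [Function.iterate_succ_apply', ih, h]
      congr 1
      apply Fin.ext
      rw [Fin.val_add]
      simp [Fin.ofNat]
  refine Nat.card_congr (Equiv.ofBijective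
    (fun x => ⟨(x.2.1, x.1 0), x.2.2.1, ?_⟩) ⟨?_, ?_⟩)
  · refine Eq.trans ?_ (minimalPeriod_add_one_fin k 0)
    exact minimalPeriod_of_semiconj x.1.injective x.2.2.2 0
  · rintro ⟨e, σ, h, hr⟩ ⟨e', σ', h', hr'⟩ heq
    simp only [Subtype.mk.injEq, Prod.mk.injEq] at heq
    obtain ⟨rfl, h0⟩ := heq
    have : e = e' := by
      ext i
      have a := hsemi e σ hr i
      have b := hsemi e' σ hr' i
      rw [h0, b] at a
      have hi : Fin.ofNat (k + 1) (i : ℕ) = i := Fin.ext (Nat.mod_eq_of_lt i.2)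
      rw [hi] at a
      rw [a]
    subst this
    rfl
  · rintro ⟨⟨σ, x⟩, h, hp⟩
    simp only at h hp
    refine ⟨⟨⟨fun i => (⇑σ)^[i] x, ?_⟩, σ, h, ?_⟩, ?_⟩
    · intro i j hij
      apply Fin.ext
      exact Function.iterate_injOn_Iio_minimalPeriod (f := (σ : Fin N → Fin N)) (x := x)
        (show (i : ℕ) ∈ Set.Iio _ by rw [Set.mem_Iio, hp]; exact i.2)
        (show (j : ℕ) ∈ Set.Iio _ by rw [Set.mem_Iio, hp]; exact j.2) hij
    · intro i
      change σ ((⇑σ)^[i] x) = (⇑σ)^[(i + 1 : Fin (k + 1))] x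
      rw [← Function.iterate_succ_apply' σ, ← Function.iterate_mod_minimalPeriod_eq, hp]
      congr 1
      rw [Fin.val_add]
      rcases k with _ | k
      · simp
      · simp
    · rfl

theorem card_goodPerm_rec (A : Set ℕ) (n : ℕ) :
    ((n + 1 : ℕ) : ℝ) * Nat.card (goodPerm A (Fin (n + 1))) =
      ∑ k ∈ Finset.range (n + 1), A.indicator (fun _ => (1 : ℝ)) (k + 1) *
        ((n + 1).descFactorial (k + 1) * Nat.card (goodPerm A (Fin (n - k)))) := by
  classical
  set P : Finset (Equiv.Perm (Fin (n + 1)) × Fin (n + 1)) :=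
    Finset.univ.filter fun p => p.1 ∈ goodPerm A (Fin (n + 1)) with hP
  have hPc : (P.card : ℝ) = ((n + 1 : ℕ) : ℝ) * Nat.card (goodPerm A (Fin (n + 1))) := by
    have : P = (Finset.univ.filter fun σ => σ ∈ goodPerm A (Fin (n + 1))) ×ˢ Finset.univ := by
      ext p; simp [hP]
    rw [this, Finset.card_product, Nat.card_eq_fintype_card, Fintype.card_subtype]
    simp [mul_comm]
  have hpos : ∀ (σ : Equiv.Perm (Fin (n + 1))) x, 0 < Function.minimalPeriod σ x := fun σ x =>
    Function.minimalPeriod_pos_of_mem_periodicPts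
      (Function.Injective.mem_periodicPts σ.injective x)
  have hmap : ∀ p ∈ P, Function.minimalPeriod p.1 p.2 - 1 ∈ Finset.range (n + 1) := by
    intro p _
    have := Function.minimalPeriod_le_card (f := p.1) (x := p.2)
    rw [Fintype.card_fin] at this
    rw [Finset.mem_range]
    have := hpos p.1 p.2
    omega
  rw [← hPc, Finset.card_eq_sum_card_fiberwise hmap]
  push_cast
  refine Finset.sum_congr rfl fun k _ => ?_
  have hset : (P.filter fun p => Function.minimalPeriod p.1 p.2 - 1 = k) =
      Finset.univ.filter fun p : Equiv.Perm (Fin (n + 1)) × Fin (n + 1) =>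
        p.1 ∈ goodPerm A (Fin (n + 1)) ∧ Function.minimalPeriod p.1 p.2 = k + 1 := by
    ext p
    have := hpos p.1 p.2
    simp only [hP, Finset.mem_filter, Finset.mem_univ, true_and]
    refine and_congr_right fun _ => ?_
    omega
  rw [hset]
  by_cases hk : k + 1 ∈ A
  · have := card_pairs A k hk (n + 1)
    rw [Nat.card_eq_fintype_card, Fintype.card_subtype] at this
    rw [this, Set.indicator_of_mem hk, one_mul, Nat.add_sub_add_right]
    push_cast; rfl
  · rw [Set.indicator_of_notMem hk, zero_mul, Nat.cast_eq_zero, Finset.card_eq_zero,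
      Finset.filter_eq_empty_iff]
    rintro p _ ⟨h1, h2⟩
    exact hk (h2 ▸ h1 p.2)

theorem main_rec (A : Set ℕ) (n : ℕ) :
    (n + 1 : ℝ) * ((Nat.card ↥(permSet A (n + 1)) : ℝ) / ((n + 1).factorial : ℝ)) =
      ∑ p ∈ Finset.HasAntidiagonal.antidiagonal n, A.indicator (fun _ => (1 : ℝ)) (p.1 + 1) *
        ((Nat.card ↥(permSet A p.2) : ℝ) / (p.2.factorial : ℝ)) := by
  have h := card_goodPerm_rec A n
  have hps : ∀ N, permSet A N = goodPerm A (Fin N) := fun N => rfl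
  simp only [hps]
  rw [Finset.Nat.sum_antidiagonal_eq_sum_range_succ_mk, ← mul_div_assoc]
  push_cast at h ⊢
  rw [h, Finset.sum_div]
  refine Finset.sum_congr rfl fun k hk => ?_
  have hk' : k ≤ n := by simpa [Nat.lt_succ_iff] using hk
  have hd : ((n - k).factorial : ℝ) * ((n + 1).descFactorial (k + 1) : ℝ) =
      ((n + 1).factorial : ℝ) := by
    have := Nat.factorial_mul_descFactorial (show k + 1 ≤ n + 1 by omega)
    rw [Nat.add_sub_add_right] at this
    exact_mod_cast this
  have h1 : ((n - k).factorial : ℝ) ≠ 0 := by positivity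
  have h2 : ((n + 1).factorial : ℝ) ≠ 0 := by positivity
  rw [div_eq_iff h2]
  field_simp
  rw [← hd]
  ring


/-- Uniqueness for the linear equation `y' = h y`, in product form. -/
theorem ps_mul_eq_one {y z h : PowerSeries ℝ}
    (hy : PowerSeries.derivative ℝ y = h * y) (hz : PowerSeries.derivative ℝ z = -h * z)
    (h0 : PowerSeries.constantCoeff y * PowerSeries.constantCoeff z = 1) : y * z = 1 := by
  apply PowerSeries.derivative.ext
  · rw [Derivation.leibniz, hy, hz, PowerSeries.derivative_one]
    simp only [smul_eq_mul]
    ring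
  · simpa using h0

theorem ps_exp_subst_deriv {g : PowerSeries ℝ} (hg : PowerSeries.constantCoeff g = 0) :
    PowerSeries.derivative ℝ ((PowerSeries.exp ℝ).subst g) =
      PowerSeries.derivative ℝ g * (PowerSeries.exp ℝ).subst g := by
  rw [PowerSeries.derivative_subst (PowerSeries.HasSubst.of_constantCoeff_zero' hg),
    PowerSeries.derivative_exp, mul_comm]

theorem ps_exp_subst_const {g : PowerSeries ℝ} (hg : PowerSeries.constantCoeff g = 0) :
    PowerSeries.constantCoeff ((PowerSeries.exp ℝ).subst g : PowerSeries ℝ) = 1 := by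
  have hs := PowerSeries.HasSubst.of_constantCoeff_zero' hg
  rw [← PowerSeries.coeff_zero_eq_constantCoeff_apply, PowerSeries.coeff_subst' hs,
    finsum_eq_single _ 0]
  · simp
  · intro n hn
    simp [hg, hn]

/-- Powers of a nonnegative summable sequence (Cauchy product). -/
theorem hasSum_coeff_pow {β : PowerSeries ℝ} {S : ℝ} (hnn : ∀ n, 0 ≤ PowerSeries.coeff n β)
    (hS : HasSum (fun n => PowerSeries.coeff n β) S) (d : ℕ) :
    (∀ n, 0 ≤ PowerSeries.coeff n (β ^ d)) ∧
      HasSum (fun n => PowerSeries.coeff n (β ^ d)) (S ^ d) := by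
  induction d with
  | zero =>
    refine ⟨fun n => ?_, ?_⟩
    · rw [pow_zero, PowerSeries.coeff_one]; split_ifs <;> norm_num
    · simp only [pow_zero, PowerSeries.coeff_one]
      exact hasSum_ite_eq 0 1
  | succ d ih =>
    obtain ⟨h1, h2⟩ := ih
    have n1 : Summable fun n => ‖PowerSeries.coeff n (β ^ d)‖ := h2.summable.norm
    have n2 : Summable fun n => ‖PowerSeries.coeff n β‖ := hS.summable.norm
    refine ⟨fun n => ?_, ?_⟩
    · rw [pow_succ, PowerSeries.coeff_mul]
      exact Finset.sum_nonneg fun p _ => mul_nonneg (h1 _) (hnn _)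
    · have a := summable_norm_sum_mul_antidiagonal_of_summable_norm n1 n2
      have b := tsum_mul_tsum_eq_tsum_sum_antidiagonal_of_summable_norm n1 n2
      rw [h2.tsum_eq, hS.tsum_eq] at b
      simp only [pow_succ (n := d), PowerSeries.coeff_mul]
      rw [b]
      exact a.of_norm.hasSum

theorem hasSum_exp_subst_neg {β : PowerSeries ℝ} {S : ℝ} (h0 : PowerSeries.constantCoeff β = 0)
    (hnn : ∀ n, 0 ≤ PowerSeries.coeff n β)
    (hS : HasSum (fun n => PowerSeries.coeff n β) S) :
    HasSum (fun n => PowerSeries.coeff n ((PowerSeries.exp ℝ).subst (-β) : PowerSeries ℝ))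
      (Real.exp (-S)) := by
  have hs : PowerSeries.HasSubst (-β) :=
    PowerSeries.HasSubst.of_constantCoeff_zero' (by simp [h0])
  obtain ⟨F, hF⟩ : ∃ F : ℕ × ℕ → ℝ, ∀ p, F p =
    (1 / (p.1.factorial : ℝ)) * PowerSeries.coeff p.2 ((-β) ^ p.1) := ⟨_, fun _ => rfl⟩
  have hneg : ∀ d n, PowerSeries.coeff n ((-β) ^ d) = (-1) ^ d * PowerSeries.coeff n (β ^ d) := by
    intro d n
    rw [neg_pow]
    have : ((-1 : PowerSeries ℝ)) ^ d = PowerSeries.C ((-1 : ℝ) ^ d) := by simp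
    rw [this, PowerSeries.coeff_C_mul]
  have hnorm : ∀ p, ‖F p‖ = (1 / (p.1.factorial : ℝ)) * PowerSeries.coeff p.2 (β ^ p.1) := by
    intro p
    rw [hF, hneg]
    simp only [norm_mul, norm_pow, norm_neg, norm_one, one_pow, one_mul]
    rw [Real.norm_of_nonneg (by positivity),
      Real.norm_of_nonneg ((hasSum_coeff_pow hnn hS p.1).1 _)]
  have hrow' : ∀ d : ℕ, HasSum (fun n => (1 / (d.factorial : ℝ)) * PowerSeries.coeff n (β ^ d))
      (S ^ d / d.factorial) := by
    intro d
    have hv : S ^ d / (d.factorial : ℝ) = (1 / (d.factorial : ℝ)) * S ^ d := by ring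
    rw [hv]
    exact (hasSum_coeff_pow hnn hS d).2.mul_left (1 / (d.factorial : ℝ))
  have hsumm : Summable F := by
    apply Summable.of_norm
    simp only [hnorm]
    rw [summable_prod_of_nonneg]
    · refine ⟨fun d => (hrow' d).summable, ?_⟩
      have : (fun d : ℕ => ∑' n, (1 / (d.factorial : ℝ)) * PowerSeries.coeff n (β ^ d)) =
          fun d : ℕ => S ^ d / d.factorial := by
        funext d
        exact (hrow' d).tsum_eq
      simp only [this]
      exact Real.summable_pow_div_factorial S
    · intro p
      exact mul_nonneg (by positivity) ((hasSum_coeff_pow hnn hS p.1).1 _)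
  have hrow : ∀ d, HasSum (fun n => F (d, n)) ((-S) ^ d / d.factorial) := by
    intro d
    have := (((hasSum_coeff_pow hnn hS d).2.mul_left ((-1) ^ d))).mul_left (1 / (d.factorial : ℝ))
    simp only [hF, hneg]
    have hv : (-S) ^ d / (d.factorial : ℝ) = (1 / (d.factorial : ℝ)) * ((-1) ^ d * S ^ d) := by
      rw [neg_pow]; ring
    rw [hv]
    exact this
  have htot : HasSum F (Real.exp (-S)) := by
    have e1 : HasSum (fun d : ℕ => (-S) ^ d / (d.factorial : ℝ)) (∑' p, F p) :=
      hsumm.hasSum.prod_fiberwise hrow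
    have e2 : Real.exp (-S) = ∑' p, F p := by
      rw [Real.exp_eq_exp_ℝ, NormedSpace.exp_eq_tsum_div, ← e1.tsum_eq]
    rw [e2]; exact hsumm.hasSum
  have hswap : HasSum (fun p : ℕ × ℕ => F p.swap) (Real.exp (-S)) :=
    (Equiv.prodComm ℕ ℕ).hasSum_iff.mpr htot
  refine hswap.prod_fiberwise fun n => ?_
  have hfin := PowerSeries.coeff_subst_finite' hs (PowerSeries.exp ℝ) n
  rw [PowerSeries.coeff_subst' hs, ← tsum_eq_finsum (L := SummationFilter.unconditional ℕ) hfin]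
  have heq : (fun d => F (Prod.swap (n, d))) =
      fun d => PowerSeries.coeff d (PowerSeries.exp ℝ) • PowerSeries.coeff n ((-β) ^ d) := by
    funext d
    simp [hF]
  rw [heq]
  exact (summable_of_hasFiniteSupport hfin).hasSum

/-- The analytic part: the recursion implies the limit. -/
theorem tendsto_of_recursion (A : Set ℕ) (b : ℕ → ℝ) (hb0 : b 0 = 1)
    (hrec : ∀ n : ℕ, (n + 1 : ℝ) * b (n + 1) =
      ∑ p ∈ Finset.HasAntidiagonal.antidiagonal n, A.indicator (fun _ => (1 : ℝ)) (p.1 + 1) * b p.2)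
    (hsum : Summable ((Aᶜ : Set ℕ).indicator fun j => (1 : ℝ) / j)) :
    Tendsto b atTop
      (𝓝 (Real.exp (-∑' j : ℕ, (Aᶜ : Set ℕ).indicator (fun j => (1 : ℝ) / j) j))) := by
  set β : PowerSeries ℝ := PowerSeries.mk ((Aᶜ : Set ℕ).indicator fun j => (1 : ℝ) / j) with hβ
  set f : PowerSeries ℝ := PowerSeries.mk b with hf
  set α' : PowerSeries ℝ := PowerSeries.mk fun n => A.indicator (fun _ => (1 : ℝ)) (n + 1) with hα
  have hf' : PowerSeries.derivative ℝ f = α' * f := by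
    ext n
    rw [PowerSeries.coeff_derivative, PowerSeries.coeff_mul]
    simp only [hf, hα, PowerSeries.coeff_mk]
    rw [mul_comm, hrec]
  have hβ0 : PowerSeries.constantCoeff β = 0 := by
    rw [← PowerSeries.coeff_zero_eq_constantCoeff_apply, hβ, PowerSeries.coeff_mk]
    by_cases h : (0 : ℕ) ∈ A <;> simp [h]
  have hαβ : α' + PowerSeries.derivative ℝ β = PowerSeries.mk 1 := by
    ext n
    rw [map_add, PowerSeries.coeff_derivative]
    simp only [hβ, hα, PowerSeries.coeff_mk]
    have : (n + 1 : ℝ) ≠ 0 := by positivity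
    by_cases h : n + 1 ∈ A
    · simp [h]
    · simp [h, this]
  have hone : (α' + PowerSeries.derivative ℝ β) * (1 - PowerSeries.X) = 1 := by
    rw [hαβ]; exact PowerSeries.mk_one_mul_one_sub_eq_one ℝ
  set g := (1 - PowerSeries.X) * f with hg
  have hg' : PowerSeries.derivative ℝ g = -PowerSeries.derivative ℝ β * g := by
    rw [hg, Derivation.leibniz, hf', map_sub, PowerSeries.derivative_one,
      PowerSeries.derivative_X]
    simp only [smul_eq_mul]
    linear_combination f * hone
  have hgE : (PowerSeries.exp ℝ).subst β * g = 1 := by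
    refine ps_mul_eq_one (ps_exp_subst_deriv hβ0) hg' ?_
    rw [ps_exp_subst_const hβ0, hg]
    have : PowerSeries.constantCoeff f = 1 := by
      rw [← PowerSeries.coeff_zero_eq_constantCoeff_apply, hf, PowerSeries.coeff_mk, hb0]
    simp [this]
  have hnβ0 : PowerSeries.constantCoeff (-β) = 0 := by simp [hβ0]
  have hcE : (PowerSeries.exp ℝ).subst β * (PowerSeries.exp ℝ).subst (-β) = 1 := by
    refine ps_mul_eq_one (ps_exp_subst_deriv hβ0) ?_ ?_
    · rw [ps_exp_subst_deriv hnβ0, map_neg]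
    · rw [ps_exp_subst_const hβ0, ps_exp_subst_const hnβ0, one_mul]
  have hgc : g = (PowerSeries.exp ℝ).subst (-β) := by
    calc g = ((PowerSeries.exp ℝ).subst β * (PowerSeries.exp ℝ).subst (-β)) * g := by
          rw [hcE, one_mul]
      _ = ((PowerSeries.exp ℝ).subst β * g) * (PowerSeries.exp ℝ).subst (-β) := by ring
      _ = _ := by rw [hgE, one_mul]
  have hfg : f = g * PowerSeries.mk 1 := by
    rw [hg, ← hαβ]
    linear_combination -f * hone
  have hbsum : ∀ N, b N = ∑ n ∈ Finset.range (N + 1), PowerSeries.coeff n g := by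
    intro N
    have := congrArg (PowerSeries.coeff N) hfg
    rw [PowerSeries.coeff_mul, Finset.Nat.sum_antidiagonal_eq_sum_range_succ_mk] at this
    simpa [hf] using this
  have hmain := hasSum_exp_subst_neg (β := β) hβ0
    (fun n => by
      rw [hβ, PowerSeries.coeff_mk]
      exact Set.indicator_nonneg (fun j _ => by positivity) n)
    (by simpa only [hβ, PowerSeries.coeff_mk] using hsum.hasSum)
  rw [← hgc] at hmain
  have := (tendsto_add_atTop_iff_nat 1).mpr hmain.tendsto_sum_nat
  exact this.congr fun N => (hbsum N).symm

/-- If `A` is an infinite set of positive integers with `Σ_{j ∉ A} 1/j < ∞`, then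
`a_N^(A)/N! → exp(−Σ_{j ∉ A} 1/j)` as `N → ∞`. -/
theorem card_permSet_div_factorial_tendsto (A : Set ℕ) (hinf : A.Infinite)
    (hpos : ∀ a ∈ A, 0 < a)
    (hsum : Summable ((Aᶜ : Set ℕ).indicator fun j => (1 : ℝ) / j)) :
    Tendsto
      (fun N : ℕ => (Nat.card ↥(permSet A N) : ℝ) / (Nat.factorial N : ℝ))
      atTop
      (𝓝 (Real.exp (-∑' j : ℕ, (Aᶜ : Set ℕ).indicator (fun j => (1 : ℝ) / j) j))) := by
  refine tendsto_of_recursion A _ ?_ (fun n => ?_) hsum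
  · have h : permSet A 0 = Set.univ := by
      ext σ
      simp [permSet]
    simp [h]
  · exact main_rec A n
end
end
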